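/- arXiv:1112.5747 — 8 statements merged into one kernel-verified Lean document; each statement's English description precedes it below -/
import Mathlib

section
/- Let K be a Markov transition kernel on [0,∞) and H an arbitrary probability distribution on [0,∞). If for each u > 0 there exists a probability distribution G_u on [0,∞) such that K(tu, t·) converges weakly to G_u on [0,∞] as t → ∞, then the function K̂ defined by K̂(u, A) = G_u(A) for u > 0 and K̂(0, A) = H(A) is a tail kernel associated with (G_1, H); in particular G_u(·) = G_1(u⁻¹·) for every u > 0. -/
open MeasureTheory ProbabilityTheory Filter Topology
open scoped NNReal ENNReal

noncomputable section

/-- A function `κ : [0,∞) → Measure [0,∞)` is the tail kernel associated with `(G, H)`: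
for `y > 0`, `κ y = G(y⁻¹ ·)` (the image of `G` under `x ↦ y * x`), and `κ 0 = H`. -/
def IsTailKernelFun (κ : ℝ≥0 → Measure ℝ≥0) (G H : Measure ℝ≥0) : Prop :=
  (∀ y : ℝ≥0, 0 < y → κ y = G.map (fun x => y * x)) ∧ κ 0 = H

/-- Finite measures on `[0,∞)` are determined by their integrals against the continuous functions
on the compactified half-line `[0,∞]`. -/
theorem NNReal.measure_ext_of_forall_integral_coe_eq {μ ν : Measure ℝ≥0}
    [IsFiniteMeasure μ] [IsFiniteMeasure ν]
    (h : ∀ f : C(ℝ≥0∞, ℝ), ∫ x : ℝ≥0, f (x : ℝ≥0∞) ∂μ = ∫ x : ℝ≥0, f (x : ℝ≥0∞) ∂ν) :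
    μ = ν := by
  have hmap : μ.map ((↑) : ℝ≥0 → ℝ≥0∞) = ν.map ((↑) : ℝ≥0 → ℝ≥0∞) := by
    refine ext_of_forall_integral_eq_of_IsFiniteMeasure fun f => ?_
    rw [integral_map measurable_coe_nnreal_ennreal.aemeasurable
        f.continuous.measurable.aestronglyMeasurable,
      integral_map measurable_coe_nnreal_ennreal.aemeasurable
        f.continuous.measurable.aestronglyMeasurable]
    exact h f.toContinuousMap
  have hback := congrArg (Measure.map ENNReal.toNNReal) hmap
  rw [Measure.map_map ENNReal.measurable_toNNReal measurable_coe_nnreal_ennreal,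
    Measure.map_map ENNReal.measurable_toNNReal measurable_coe_nnreal_ennreal] at hback
  have hid : ENNReal.toNNReal ∘ ((↑) : ℝ≥0 → ℝ≥0∞) = id := by ext; simp
  simpa only [hid, Measure.map_id] using hback

/-- If for each `u > 0` the measures `K(tu, t·)` converge weakly on `[0,∞]` to some
probability distribution `G_u` as `t → ∞`, then `K̂(u,·) = G_u` for `u > 0`,
`K̂(0,·) = H`, is a tail kernel associated with `(G_1, H)`; in particular
`G_u(·) = G_1(u⁻¹·)` for every `u > 0`. -/
theorem limit_is_tail_kernel (K : Kernel ℝ≥0 ℝ≥0) [IsMarkovKernel K]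
    (H : Measure ℝ≥0) [IsProbabilityMeasure H]
    (G : ℝ≥0 → Measure ℝ≥0) (hGprob : ∀ u : ℝ≥0, 0 < u → IsProbabilityMeasure (G u))
    (hconv : ∀ u : ℝ≥0, 0 < u → ∀ f : C(ℝ≥0∞, ℝ),
      Tendsto (fun t : ℝ≥0 => ∫ x, f ((x / t : ℝ≥0) : ℝ≥0∞) ∂(K (t * u)))
        atTop (𝓝 (∫ x, f (x : ℝ≥0∞) ∂(G u)))) :
    IsTailKernelFun (fun u => if u = 0 then H else G u) (G 1) H ∧
      ∀ u : ℝ≥0, 0 < u → G u = (G 1).map (fun x => u * x) := by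
  have key : ∀ u : ℝ≥0, 0 < u → G u = (G 1).map (fun x => u * x) := by
    intro u hu
    have := hGprob u hu
    have := hGprob 1 one_pos
    have hmeas : Measurable fun x : ℝ≥0 => u * x := measurable_const_mul u
    have := Measure.isProbabilityMeasure_map (μ := G 1) hmeas.aemeasurable
    refine NNReal.measure_ext_of_forall_integral_coe_eq fun f => ?_
    rw [integral_map (f := fun x : ℝ≥0 => f (x : ℝ≥0∞)) hmeas.aemeasurable
      (f.continuous.comp ENNReal.continuous_coe).measurable.aestronglyMeasurable]
    let g : C(ℝ≥0∞, ℝ) :=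
      ⟨fun x => f (u * x), f.continuous.comp (ENNReal.continuous_const_mul ENNReal.coe_ne_top)⟩
    have hscaled : Tendsto (fun t : ℝ≥0 => ∫ x, f ((x / t : ℝ≥0) : ℝ≥0∞) ∂(K (t * u))) atTop
        (𝓝 (∫ x : ℝ≥0, f ((u * x : ℝ≥0) : ℝ≥0∞) ∂(G 1))) := by
      have hg := (hconv 1 one_pos g).comp (tendsto_id.atTop_mul_const hu)
      simp only [g, ContinuousMap.coe_mk, ← ENNReal.coe_mul] at hg
      refine hg.congr fun t => ?_
      have hdiv (x : ℝ≥0) : u * (x / (t * u)) = x / t := by field_simp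
      simp only [Function.comp_apply, id_eq, mul_one, hdiv]
    exact tendsto_nhds_unique (hconv u hu f) hscaled
  exact ⟨⟨fun y hy => by simpa only [hy.ne', if_false] using key y hy, if_pos rfl⟩, key⟩
end
end

section
/- Suppose K ∈ D(G) and let K* be a tail kernel associated with G (with any boundary distribution). Then for any u > 0 and any nonnegative function u_t = u(t) with u_t → u as t → ∞, the measures K(tu_t, t·) converge weakly on [0,∞] to K*(u, ·) = G(u⁻¹·) as t → ∞. -/
open MeasureTheory ProbabilityTheory Filter Topology
open scoped NNReal ENNReal

noncomputable section

/-- `K ∈ D(G)`: the transition kernel `K` is in the domain of attraction of `G`, i.e.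
`K(t, t·)` converges weakly to `G` on the compactified half-line `[0,∞]` as `t → ∞`. -/
def KernelDOA (K : Kernel ℝ≥0 ℝ≥0) (G : Measure ℝ≥0) : Prop :=
  ∀ f : C(ℝ≥0∞, ℝ),
    Tendsto (fun t : ℝ≥0 => ∫ x, f ((x / t : ℝ≥0) : ℝ≥0∞) ∂(K t))
      atTop (𝓝 (∫ x, f (x : ℝ≥0∞) ∂G))

/-- Dilation by `c > 0` on the compact space `[0,∞]` is continuous in `c`, uniformly after
composition with a continuous function. -/
theorem tendstoUniformly_comp_coe_mul (f : C(ℝ≥0∞, ℝ)) {u : ℝ≥0} (hu : 0 < u) :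
    TendstoUniformly (fun (c : ℝ≥0) (y : ℝ≥0∞) => f (c * y)) (fun y => f (u * y)) (𝓝 u) := by
  rw [← tendstoLocallyUniformly_iff_tendstoUniformly_of_compactSpace,
    tendstoLocallyUniformly_iff_forall_tendsto]
  intro y
  have hu' : (u : ℝ≥0∞) ≠ 0 := ENNReal.coe_ne_zero.2 hu.ne'
  have hy {c : ℝ≥0 × ℝ≥0∞ → ℝ≥0} (hc : Tendsto c (𝓝 u ×ˢ 𝓝 y) (𝓝 u)) :
      Tendsto (fun p => f (c p * p.2)) (𝓝 u ×ˢ 𝓝 y) (𝓝 (f (u * y))) :=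
    (f.continuous.tendsto _).comp (ENNReal.Tendsto.mul (ENNReal.tendsto_coe.2 hc)
      (Or.inl hu') tendsto_snd (Or.inr ENNReal.coe_ne_top))
  exact ((hy tendsto_const_nhds).prodMk_nhds (hy tendsto_fst)).mono_right (nhds_le_uniformity _)

/-- If `K ∈ D(G)` and `K*` is a tail kernel associated with `G`, then for every `u > 0`
and every nonnegative function `u_t → u`, the measures `K(t u_t, t·)` converge weakly on
`[0,∞]` to `K*(u, ·) = G(u⁻¹·)` as `t → ∞`. -/
theorem kernel_doa_uniform_conv (K : Kernel ℝ≥0 ℝ≥0) [IsMarkovKernel K]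
    (G : Measure ℝ≥0) [IsProbabilityMeasure G] (hK : KernelDOA K G)
    (u : ℝ≥0) (hu : 0 < u) (ut : ℝ≥0 → ℝ≥0) (hut : Tendsto ut atTop (𝓝 u))
    (f : C(ℝ≥0∞, ℝ)) :
    Tendsto (fun t : ℝ≥0 => ∫ x, f ((x / t : ℝ≥0) : ℝ≥0∞) ∂(K (t * ut t)))
      atTop (𝓝 (∫ x, f ((u * x : ℝ≥0) : ℝ≥0∞) ∂G)) := by
  have hscale : Tendsto (fun t : ℝ≥0 => t * ut t) atTop atTop := by
    have hpos : ∀ᶠ t in atTop, u / 2 ≤ ut t :=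
      hut.eventually (Ici_mem_nhds (half_lt_self hu))
    refine tendsto_atTop_mono' atTop ?_
      (tendsto_id.atTop_mul_const (half_pos hu))
    filter_upwards [hpos] with t ht
    exact mul_le_mul_right ht t
  let g : C(ℝ≥0∞, ℝ) := ⟨fun y => f (u * y),
    f.continuous.comp (ENNReal.continuous_const_mul ENNReal.coe_ne_top)⟩
  have hg : Tendsto (fun t : ℝ≥0 => ∫ x, g ((x / (t * ut t) : ℝ≥0) : ℝ≥0∞) ∂(K (t * ut t)))
      atTop (𝓝 (∫ x, f ((u * x : ℝ≥0) : ℝ≥0∞) ∂G)) := by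
    simpa [g, Function.comp_def] using (hK g).comp hscale
  refine (tendsto_iff_of_dist ?_).1 hg
  have hint (h : C(ℝ≥0∞, ℝ)) (s t : ℝ≥0) :
      Integrable (fun x : ℝ≥0 => h ((x / t : ℝ≥0) : ℝ≥0∞)) (K s) := by
    refine Integrable.of_bound (C := ‖h‖) ?_ (ae_of_all _ fun x => h.norm_coe_le_norm _)
    exact (h.continuous.measurable.comp (by fun_prop)).aestronglyMeasurable
  rw [Metric.tendsto_nhds]
  intro ε hε
  have hunif := hut.eventually
    (Metric.tendstoUniformly_iff.1 (tendstoUniformly_comp_coe_mul f hu) (ε / 2) (half_pos hε))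
  filter_upwards [hunif, hut.eventually (Ioi_mem_nhds hu)] with t ht hpos
  have hpos' : ut t ≠ 0 := ne_of_gt hpos
  rw [Real.dist_0_eq_abs, abs_of_nonneg dist_nonneg, dist_eq_norm,
    ← integral_sub (hint g _ _) (hint f _ _)]
  refine (norm_integral_le_of_norm_le_const (C := ε / 2) (ae_of_all _ fun x => ?_)).trans_lt ?_
  · have hx : x / t = ut t * (x / (t * ut t)) := by
      rw [← mul_div_assoc, mul_comm (ut t), mul_div_mul_right _ _ hpos']
    rw [← dist_eq_norm, hx, ENNReal.coe_mul]
    exact (ht _).le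
  · simpa using half_lt_self hε
end
end

section
/- Let K be a Markov transition kernel on [0,∞) and G a probability distribution on [0,∞). Then K ∈ D(G) if and only if there exist a measurable function ψ* : [0,∞) × [0,1] → [0,∞) and a random variable ξ* : [0,1] → [0,∞) with distribution G under Lebesgue measure λ on [0,1], such that ψ*(t,u)/t → ξ*(u) as t → ∞ for every u ∈ [0,1], and ψ* is an update function corresponding to K in the sense that λ{u ∈ [0,1] : ψ*(y,u) ∈ A} = K(y,A) for every y ≥ 0 and every Borel set A. -/
open MeasureTheory ProbabilityTheory Filter Topology
open scoped NNReal ENNReal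

noncomputable section

/-- Lebesgue measure on `[0,1]`. -/
def unifLaw : Measure ℝ := (volume : Measure ℝ).restrict (Set.Icc 0 1)

/-- The quantile function of `μ` at levels in `(0, 1) \ N`, set to `0` at all other levels. -/
def quantileOff (N : Set ℝ) (μ : Measure ℝ≥0) (u : ℝ) : ℝ≥0 :=
  open scoped Classical in
  if u ∈ Set.Ioo (0 : ℝ) 1 \ N then sInf {x : ℝ≥0 | u ≤ μ.real (Set.Iic x)} else 0

theorem quantileOff_of_notMem {N : Set ℝ} {μ : Measure ℝ≥0} {u : ℝ}
    (hu : u ∉ Set.Ioo (0 : ℝ) 1 \ N) : quantileOff N μ u = 0 := by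
  unfold quantileOff
  rw [if_neg hu]

theorem quantileOff_le_iff {N : Set ℝ} {μ : Measure ℝ≥0} [IsProbabilityMeasure μ] {u : ℝ}
    (hu : u ∈ Set.Ioo (0 : ℝ) 1 \ N) (x : ℝ≥0) :
    quantileOff N μ u ≤ x ↔ u ≤ μ.real (Set.Iic x) := by
  unfold quantileOff
  rw [if_pos hu]
  refine ⟨fun h => ?_, fun h => csInf_le (OrderBot.bddBelow _) h⟩
  have hne : {x : ℝ≥0 | u ≤ μ.real (Set.Iic x)}.Nonempty := by
    have h1 : Tendsto (fun x : ℝ≥0 => μ.real (Set.Iic x)) atTop (𝓝 1) := by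
      have := (ENNReal.tendsto_toReal (measure_ne_top μ Set.univ)).comp
        (tendsto_measure_Iic_atTop μ)
      simpa [Measure.real, Function.comp_def] using this
    obtain ⟨y, hy⟩ := (h1.eventually (lt_mem_nhds hu.1.2)).exists
    exact ⟨y, hy.le⟩
  have hlt : ∀ y, x < y → u ≤ μ.real (Set.Iic y) := fun y hy => by
    obtain ⟨z, hz, hzy⟩ := exists_lt_of_csInf_lt hne (h.trans_lt hy)
    exact le_trans hz (measureReal_mono (Set.Iic_subset_Iic.2 hzy.le))
  obtain ⟨v, hv_anti, hv_gt, hv_lim⟩ := exists_seq_strictAnti_tendsto x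
  have hInter : ⋂ n, Set.Iic (v n) = Set.Iic x := by
    ext z
    simp only [Set.mem_iInter, Set.mem_Iic]
    exact ⟨fun hz => ge_of_tendsto' hv_lim hz, fun hz n => hz.trans (hv_gt n).le⟩
  have hlim : Tendsto (fun n => μ.real (Set.Iic (v n))) atTop (𝓝 (μ.real (Set.Iic x))) := by
    rw [← hInter]
    refine (ENNReal.tendsto_toReal (measure_ne_top μ _)).comp
      (tendsto_measure_iInter_atTop (fun n => measurableSet_Iic.nullMeasurableSet)
        (fun m n hmn => Set.Iic_subset_Iic.2 (hv_anti.antitone hmn)) ⟨0, measure_ne_top _ _⟩)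
  exact ge_of_tendsto' hlim fun n => hlt _ (hv_gt n)

theorem measurable_uncurry_quantileOff {N : Set ℝ} (hN : N.Countable) {α : Type*}
    [MeasurableSpace α] (K : Kernel α ℝ≥0) [IsMarkovKernel K] :
    Measurable (Function.uncurry fun t u => quantileOff N (K t) u) := by
  refine measurable_of_Iic fun x => ?_
  have hS : MeasurableSet (Set.Ioo (0 : ℝ) 1 \ N) := measurableSet_Ioo.diff hN.measurableSet
  have heq : (Function.uncurry fun t u => quantileOff N (K t) u) ⁻¹' Set.Iic x =
      Prod.snd ⁻¹' (Set.Ioo (0 : ℝ) 1 \ N)ᶜ ∪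
        Prod.snd ⁻¹' (Set.Ioo (0 : ℝ) 1 \ N) ∩
          {p : α × ℝ | p.2 ≤ (K p.1).real (Set.Iic x)} := by
    ext ⟨t, u⟩
    by_cases hu : u ∈ Set.Ioo (0 : ℝ) 1 \ N
    · simp only [Set.mem_preimage, Function.uncurry_apply_pair, Set.mem_Iic, Set.mem_union,
        Set.mem_compl_iff, Set.mem_inter_iff, Set.mem_ofPred_eq, hu, quantileOff_le_iff hu,
        not_true_eq_false, false_or, true_and]
    · simp only [Set.mem_preimage, Function.uncurry_apply_pair, Set.mem_Iic, Set.mem_union,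
        Set.mem_compl_iff, hu, quantileOff_of_notMem hu, zero_le, not_false_eq_true, true_or]
  rw [heq]
  refine (measurable_snd hS.compl).union ((measurable_snd hS).inter ?_)
  exact measurableSet_le measurable_snd
    ((K.measurable_coe measurableSet_Iic).ennreal_toReal.comp measurable_fst)

theorem measurable_quantileOff {N : Set ℝ} (hN : N.Countable) (μ : Measure ℝ≥0)
    [IsProbabilityMeasure μ] : Measurable (quantileOff N μ) :=
  (measurable_uncurry_quantileOff hN (Kernel.const Unit μ)).comp (measurable_prodMk_left (x := ()))

instance : IsProbabilityMeasure unifLaw := ⟨by simp [unifLaw]⟩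

theorem map_quantileOff {N : Set ℝ} (hN : N.Countable) (μ : Measure ℝ≥0)
    [IsProbabilityMeasure μ] : Measure.map (quantileOff N μ) unifLaw = μ := by
  have hm := measurable_quantileOff hN μ
  have : IsProbabilityMeasure (Measure.map (quantileOff N μ) unifLaw) :=
    Measure.isProbabilityMeasure_map hm.aemeasurable
  refine Measure.ext_of_Iic _ _ fun x => ?_
  rw [Measure.map_apply hm measurableSet_Iic]
  have hae : ∀ᵐ u ∂unifLaw, u ∈ Set.Ioo (0 : ℝ) 1 \ N := by
    have hbad : (N ∪ {0, 1} : Set ℝ).Countable := hN.union (Set.toFinite _).countable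
    filter_upwards [ae_restrict_mem (μ := (volume : Measure ℝ)) measurableSet_Icc,
      ae_restrict_of_ae (s := Set.Icc (0 : ℝ) 1) (hbad.ae_notMem volume)] with u hu hu'
    simp only [Set.mem_union, Set.mem_insert_iff, Set.mem_singleton_iff, not_or] at hu'
    exact ⟨⟨lt_of_le_of_ne hu.1 (Ne.symm hu'.2.1), lt_of_le_of_ne hu.2 hu'.2.2⟩, hu'.1⟩
  have hset : (quantileOff N μ ⁻¹' Set.Iic x : Set ℝ) =ᵐ[unifLaw]
      Set.Iic (μ.real (Set.Iic x)) := by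
    filter_upwards [hae] with u hu
    exact propext (quantileOff_le_iff hu x)
  have hinter : Set.Iic (μ.real (Set.Iic x)) ∩ Set.Icc 0 1 =
      Set.Icc (0 : ℝ) (μ.real (Set.Iic x)) := by
    ext u
    have h1 : μ.real (Set.Iic x) ≤ 1 := measureReal_le_one
    simp only [Set.mem_inter_iff, Set.mem_Iic, Set.mem_Icc]
    exact ⟨fun h => ⟨h.2.1, h.1⟩, fun h => ⟨h.2, h.1, h.2.trans h1⟩⟩
  rw [measure_congr hset, unifLaw, Measure.restrict_apply measurableSet_Iic, hinter,
    Real.volume_Icc, sub_zero, ofReal_measureReal]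

/-- A continuous function on `[0, ∞]` which interpolates between the indicators of `[0, a]`
and `[0, b]`. -/
theorem exists_continuousMap_between_indicators {a b : ℝ≥0} (hab : a < b) :
    ∃ f : C(ℝ≥0∞, ℝ), ∀ y : ℝ≥0,
      (Set.Iic a).indicator (fun _ => (1 : ℝ)) y ≤ f y ∧
        f y ≤ (Set.Iic b).indicator (fun _ => (1 : ℝ)) y := by
  have hd : Disjoint (Set.Ici (b : ℝ≥0∞)) (Set.Iic (a : ℝ≥0∞)) :=
    Set.disjoint_left.2 fun y hy hy' =>
      absurd (le_trans hy hy') (not_le.2 (ENNReal.coe_lt_coe.2 hab))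
  obtain ⟨f, hf0, hf1, hf⟩ := exists_continuous_zero_one_of_isClosed isClosed_Ici isClosed_Iic hd
  refine ⟨f, fun y => ⟨?_, ?_⟩⟩
  · by_cases hy : y ∈ Set.Iic a
    · rw [Set.indicator_of_mem hy, hf1 (show (y : ℝ≥0∞) ≤ a from ENNReal.coe_le_coe.2 hy)]
      rfl
    · rw [Set.indicator_of_notMem hy]
      exact (hf y).1
  · by_cases hy : y ∈ Set.Iic b
    · rw [Set.indicator_of_mem hy]
      exact (hf y).2
    · rw [Set.indicator_of_notMem hy,
        hf0 (show (b : ℝ≥0∞) ≤ y from ENNReal.coe_le_coe.2 (not_le.1 hy).le)]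
      rfl

theorem integrable_continuousMap_comp_coe (μ : Measure ℝ≥0) [IsFiniteMeasure μ]
    (f : C(ℝ≥0∞, ℝ)) {g : ℝ≥0 → ℝ≥0} (hg : Measurable g) :
    Integrable (fun x => f (g x : ℝ≥0∞)) μ :=
  Integrable.of_bound
    (f.continuous.measurable.comp (measurable_coe_nnreal_ennreal.comp hg)).aestronglyMeasurable
    ‖f‖ (Eventually.of_forall fun _ => f.norm_coe_le_norm _)

theorem measureReal_le_integral_le (μ : Measure ℝ≥0) [IsFiniteMeasure μ] {a b : ℝ≥0}
    {f : C(ℝ≥0∞, ℝ)}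
    (hf : ∀ y : ℝ≥0, (Set.Iic a).indicator (fun _ => (1 : ℝ)) y ≤ f y ∧
      f y ≤ (Set.Iic b).indicator (fun _ => (1 : ℝ)) y)
    {g : ℝ≥0 → ℝ≥0} (hg : Measurable g) :
    μ.real (g ⁻¹' Set.Iic a) ≤ ∫ x, f (g x : ℝ≥0∞) ∂μ ∧
      ∫ x, f (g x : ℝ≥0∞) ∂μ ≤ μ.real (g ⁻¹' Set.Iic b) := by
  have hi := integrable_continuousMap_comp_coe μ f hg
  have hind : ∀ c : ℝ≥0, Integrable ((g ⁻¹' Set.Iic c).indicator fun _ => (1 : ℝ)) μ :=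
    fun c => (integrable_const 1).indicator (hg measurableSet_Iic)
  have hint : ∀ c : ℝ≥0, ∫ x, (g ⁻¹' Set.Iic c).indicator (fun _ => (1 : ℝ)) x ∂μ =
      μ.real (g ⁻¹' Set.Iic c) := fun c => by
    rw [integral_indicator_const _ (hg measurableSet_Iic), smul_eq_mul, mul_one]
  rw [← hint a, ← hint b]
  exact ⟨integral_mono (hind a) hi fun x => (hf (g x)).1,
    integral_mono hi (hind b) fun x => (hf (g x)).2⟩

theorem preimage_div_Iic {t : ℝ≥0} (ht : 0 < t) (a : ℝ≥0) :
    (fun x : ℝ≥0 => x / t) ⁻¹' Set.Iic a = Set.Iic (a * t) := by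
  ext x
  exact div_le_iff₀ ht

namespace KernelDOA

variable {K : Kernel ℝ≥0 ℝ≥0} [IsMarkovKernel K] {G : Measure ℝ≥0} [IsProbabilityMeasure G]

theorem eventually_lt (h : KernelDOA K G) {a b : ℝ≥0} (hab : a < b) {c : ℝ}
    (hc : G.real (Set.Iic b) < c) : ∀ᶠ t in atTop, (K t).real (Set.Iic (a * t)) < c := by
  obtain ⟨f, hf⟩ := exists_continuousMap_between_indicators hab
  have hG := (measureReal_le_integral_le G hf measurable_id).2
  filter_upwards [(h f).eventually (gt_mem_nhds (lt_of_le_of_lt hG hc)), eventually_gt_atTop 0]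
    with t ht ht0
  rw [← preimage_div_Iic ht0]
  exact (measureReal_le_integral_le (K t) hf (measurable_id.div_const t)).1.trans_lt ht

theorem eventually_gt (h : KernelDOA K G) {a b : ℝ≥0} (hab : a < b) {c : ℝ}
    (hc : c < G.real (Set.Iic a)) : ∀ᶠ t in atTop, c < (K t).real (Set.Iic (b * t)) := by
  obtain ⟨f, hf⟩ := exists_continuousMap_between_indicators hab
  have hG := (measureReal_le_integral_le G hf measurable_id).1
  filter_upwards [(h f).eventually (lt_mem_nhds (lt_of_lt_of_le hc hG)), eventually_gt_atTop 0]
    with t ht ht0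
  rw [← preimage_div_Iic ht0]
  exact ht.trans_le (measureReal_le_integral_le (K t) hf (measurable_id.div_const t)).2

theorem tendsto_quantileOff_div (h : KernelDOA K G) {N : Set ℝ} {D : Set ℝ≥0} (hD : Dense D)
    (hN : ∀ x ∈ D, G.real (Set.Iic x) ∈ N) (u : ℝ) :
    Tendsto (fun t : ℝ≥0 => quantileOff N (K t) u / t) atTop (𝓝 (quantileOff N G u)) := by
  by_cases hu : u ∈ Set.Ioo (0 : ℝ) 1 \ N
  swap
  · simp [quantileOff_of_notMem hu]
  refine tendsto_order.2 ⟨fun a ha => ?_, fun b hb => ?_⟩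
  · obtain ⟨a', haa', ha'⟩ := exists_between ha
    have hG : G.real (Set.Iic a') < u := by
      rw [← not_le, ← quantileOff_le_iff hu, not_le]
      exact ha'
    filter_upwards [h.eventually_lt haa' hG, eventually_gt_atTop 0] with t ht ht0
    rwa [lt_div_iff₀ ht0, ← not_le, quantileOff_le_iff hu, not_le]
  · obtain ⟨b', hb', hb'b⟩ := exists_between hb
    obtain ⟨x, hxD, hx, hxb'⟩ := hD.exists_between hb'
    have hG : u < G.real (Set.Iic x) := by
      refine lt_of_le_of_ne ((quantileOff_le_iff hu x).1 hx.le) ?_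
      rintro rfl
      exact hu.2 (hN x hxD)
    filter_upwards [h.eventually_gt hxb' hG, eventually_gt_atTop 0] with t ht ht0
    refine lt_of_le_of_lt ?_ hb'b
    rw [div_le_iff₀ ht0, quantileOff_le_iff hu]
    exact ht.le

end KernelDOA

/-- `K ∈ D(G)` iff there is an update function `ψ*` corresponding to `K`, defined on the
uniform probability space `[0,1]`, and a random variable `ξ*` with distribution `G`, such
that `ψ*(t,u)/t → ξ*(u)` as `t → ∞` for every `u ∈ [0,1]`. -/
theorem kernel_doa_iff_update_function (K : Kernel ℝ≥0 ℝ≥0) [IsMarkovKernel K]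
    (G : Measure ℝ≥0) [IsProbabilityMeasure G] :
    KernelDOA K G ↔
      ∃ (ψ : ℝ≥0 → ℝ → ℝ≥0) (ξ : ℝ → ℝ≥0),
        Measurable (Function.uncurry ψ) ∧ Measurable ξ ∧
        Measure.map ξ unifLaw = G ∧
        (∀ u ∈ Set.Icc (0:ℝ) 1,
          Tendsto (fun t : ℝ≥0 => ψ t u / t) atTop (𝓝 (ξ u))) ∧
        (∀ y : ℝ≥0, Measure.map (fun u => ψ y u) unifLaw = K y) := by
  constructor
  · intro h
    obtain ⟨D, hDc, hD⟩ := TopologicalSpace.exists_countable_dense ℝ≥0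
    obtain ⟨N, hN, hDN⟩ : ∃ N : Set ℝ, N.Countable ∧ ∀ x ∈ D, G.real (Set.Iic x) ∈ N :=
      ⟨(fun x => G.real (Set.Iic x)) '' D, hDc.image _, fun x hx => ⟨x, hx, rfl⟩⟩
    exact ⟨fun t u => quantileOff N (K t) u, quantileOff N G,
      measurable_uncurry_quantileOff hN K, measurable_quantileOff hN G, map_quantileOff hN G,
      fun u _ => h.tendsto_quantileOff_div hD hDN u, fun y => map_quantileOff hN (K y)⟩
  · rintro ⟨ψ, ξ, hψ, hξ, rfl, hlim, hK⟩ f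
    have hf : Measurable fun x : ℝ≥0 => f (x : ℝ≥0∞) :=
      f.continuous.measurable.comp measurable_coe_nnreal_ennreal
    have hψt : ∀ t, Measurable (ψ t) := fun t => hψ.comp measurable_prodMk_left
    have hfdiv : ∀ t : ℝ≥0, Measurable fun x : ℝ≥0 => f ((x / t : ℝ≥0) : ℝ≥0∞) :=
      fun t => hf.comp (measurable_id.div_const t)
    have hG := integral_map (μ := unifLaw) hξ.aemeasurable hf.aestronglyMeasurable
    have heq : (fun t : ℝ≥0 => ∫ x, f ((x / t : ℝ≥0) : ℝ≥0∞) ∂(K t)) =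
        fun t => ∫ u, f ((ψ t u / t : ℝ≥0) : ℝ≥0∞) ∂unifLaw := by
      funext t
      rw [← hK t]
      exact integral_map (μ := unifLaw) (f := fun x : ℝ≥0 => f ((x / t : ℝ≥0) : ℝ≥0∞))
        (hψt t).aemeasurable (hfdiv t).aestronglyMeasurable
    rw [heq, hG]
    refine tendsto_integral_filter_of_dominated_convergence (fun _ => ‖f‖)
      (Eventually.of_forall fun t => ((hfdiv t).comp (hψt t)).aestronglyMeasurable)
      (Eventually.of_forall fun t => Eventually.of_forall fun u => f.norm_coe_le_norm _)
      (integrable_const _) ?_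
    filter_upwards [ae_restrict_mem (μ := (volume : Measure ℝ)) measurableSet_Icc] with u hu
    exact (f.continuous.tendsto _).comp (ENNReal.tendsto_coe.2 (hlim u hu))
end
end

section
/- Let K be a Markov transition kernel on [0,∞) and G a probability distribution on [0,∞). Then K ∈ D(G) if and only if there exist a random variable ξ : [0,1] → [0,∞) with distribution G under Lebesgue measure λ on [0,1], and a measurable function φ : [0,∞) × [0,1] → (-∞,∞) satisfying φ(t,u)/t → 0 as t → ∞ for every u ∈ [0,1], such that ψ(y,u) := ξ(u)·y + φ(y,u) takes values in [0,∞) and is an update function corresponding to K, i.e., λ{u ∈ [0,1] : ψ(y,u) ∈ A} = K(y,A) for every y ≥ 0 and every Borel set A. -/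
open MeasureTheory ProbabilityTheory Filter Topology
open scoped NNReal ENNReal

noncomputable section

/-- The quantile function of a measure on `[0,∞)`, set to `0` on `[1,∞)`. -/
def quantile (μ : Measure ℝ≥0) (u : ℝ) : ℝ≥0 :=
  if u < 1 then sInf {x | u ≤ μ.real (Set.Iic x)} else 0

theorem tendsto_measureReal_Iic_nhdsGT (μ : Measure ℝ≥0) [IsFiniteMeasure μ] (x : ℝ≥0) :
    Tendsto (fun z => μ.real (Set.Iic z)) (𝓝[>] x) (𝓝 (μ.real (Set.Iic x))) := by
  have h := tendsto_measure_biInter_gt (μ := μ) (s := fun z : ℝ≥0 => Set.Iic z) (a := x)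
    (fun r _ => measurableSet_Iic.nullMeasurableSet)
    (fun i j _ hij => Set.Iic_subset_Iic.2 hij) ⟨x + 1, by simp, measure_ne_top _ _⟩
  have hI : ⋂ r > x, Set.Iic r = Set.Iic x := by
    ext z
    simp only [Set.mem_iInter, Set.mem_Iic]
    exact ⟨fun h => le_of_forall_gt_imp_ge_of_dense h, fun h r hr => h.trans hr.le⟩
  rw [hI] at h
  exact (ENNReal.tendsto_toReal (measure_ne_top _ _)).comp h

theorem exists_le_measureReal_Iic (μ : Measure ℝ≥0) [IsProbabilityMeasure μ] {u : ℝ}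
    (hu : u < 1) : ∃ x, u ≤ μ.real (Set.Iic x) := by
  have h := tendsto_measure_iUnion_atTop (μ := μ) (s := fun z : ℝ≥0 => Set.Iic z)
    (fun _ _ hij => Set.Iic_subset_Iic.2 hij)
  rw [Set.iUnion_Iic, measure_univ] at h
  have h' := (ENNReal.tendsto_toReal ENNReal.one_ne_top).comp h
  obtain ⟨x, hx⟩ := (h'.eventually (lt_mem_nhds (by simpa using hu))).exists
  exact ⟨x, le_of_lt hx⟩

theorem quantile_le_iff (μ : Measure ℝ≥0) [IsProbabilityMeasure μ] {u : ℝ} (hu : u < 1)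
    (x : ℝ≥0) : quantile μ u ≤ x ↔ u ≤ μ.real (Set.Iic x) := by
  rw [quantile, if_pos hu]
  refine ⟨fun h => ?_, fun h => csInf_le (OrderBot.bddBelow _) h⟩
  refine ge_of_tendsto (tendsto_measureReal_Iic_nhdsGT μ x) ?_
  filter_upwards [self_mem_nhdsWithin] with z hz
  obtain ⟨w, hw, hwz⟩ := exists_lt_of_csInf_lt (exists_le_measureReal_Iic μ hu) (h.trans_lt hz)
  exact (show u ≤ _ from hw).trans (measureReal_mono (Set.Iic_subset_Iic.2 hwz.le))

theorem lt_quantile_iff (μ : Measure ℝ≥0) [IsProbabilityMeasure μ] {u : ℝ} (hu : u < 1)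
    (x : ℝ≥0) : x < quantile μ u ↔ μ.real (Set.Iic x) < u := by
  rw [← not_le, quantile_le_iff μ hu, not_le]

theorem monotoneOn_quantile (μ : Measure ℝ≥0) [IsProbabilityMeasure μ] :
    MonotoneOn (quantile μ) (Set.Iio 1) := fun _ hu _ hv huv =>
  (quantile_le_iff μ hu _).2 (huv.trans ((quantile_le_iff μ hv _).1 le_rfl))

theorem measurable_quantile_kernel {α : Type*} [MeasurableSpace α] (K : Kernel α ℝ≥0)
    [IsMarkovKernel K] : Measurable fun p : α × ℝ => quantile (K p.1) p.2 := by
  refine measurable_of_Iic fun x => ?_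
  have hset : (fun p : α × ℝ => quantile (K p.1) p.2) ⁻¹' Set.Iic x =
      {p | p.2 ≤ (K p.1).real (Set.Iic x)} ∪ {p | 1 ≤ p.2} := by
    ext p
    simp only [Set.mem_preimage, Set.mem_Iic, Set.mem_union, Set.mem_ofPred_eq]
    rcases lt_or_ge p.2 1 with h | h
    · simp [quantile_le_iff (K p.1) h, h.not_ge]
    · simp [quantile, h, h.not_gt]
  rw [hset]
  refine (measurableSet_le measurable_snd ?_).union
    (measurableSet_le measurable_const measurable_snd)
  exact ((K.measurable_coe measurableSet_Iic).comp measurable_fst).ennreal_toReal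

theorem measurable_quantile (μ : Measure ℝ≥0) [IsProbabilityMeasure μ] :
    Measurable (quantile μ) :=
  (measurable_quantile_kernel (Kernel.const Unit μ)).comp (measurable_prodMk_left (x := ()))

theorem map_quantile_unifLaw (μ : Measure ℝ≥0) [IsProbabilityMeasure μ] :
    Measure.map (quantile μ) unifLaw = μ := by
  have : IsProbabilityMeasure unifLaw := ⟨by simp [unifLaw]⟩
  have := Measure.isProbabilityMeasure_map (μ := unifLaw) (measurable_quantile μ).aemeasurable
  refine Measure.ext_of_Iic _ _ fun x => ?_
  rw [Measure.map_apply (measurable_quantile μ) measurableSet_Iic, unifLaw,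
    Measure.restrict_congr_set Ico_ae_eq_Icc.symm,
    Measure.restrict_apply (measurable_quantile μ measurableSet_Iic)]
  have hset : quantile μ ⁻¹' Set.Iic x ∩ Set.Ico 0 1 =
      Set.Iic (μ.real (Set.Iic x)) ∩ Set.Ico 0 1 := by
    ext u
    simp only [Set.mem_inter_iff, Set.mem_preimage, Set.mem_Iic, and_congr_left_iff]
    exact fun hu => quantile_le_iff μ hu.2 x
  have hset' : Set.Iic (μ.real (Set.Iic x)) ∩ Set.Icc 0 1 = Set.Icc 0 (μ.real (Set.Iic x)) := by
    ext u
    have : μ.real (Set.Iic x) ≤ 1 := measureReal_le_one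
    simp only [Set.mem_inter_iff, Set.mem_Iic, Set.mem_Icc]
    exact ⟨fun h => ⟨h.2.1, h.1⟩, fun h => ⟨h.2, h.1, h.2.trans this⟩⟩
  rw [hset, measure_congr ((ae_eq_refl _).inter Ico_ae_eq_Icc), hset', Real.volume_Icc, sub_zero,
    ofReal_measureReal]

/-- A continuous function on `[0,∞]` separating `[0,a]` from `[b,∞]`. -/
theorem exists_continuousMap_indicator_Iic {a b : ℝ≥0} (hab : a < b) :
    ∃ f : C(ℝ≥0∞, ℝ), ∀ x : ℝ≥0, (Set.Iic a).indicator 1 x ≤ f x ∧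
      f x ≤ (Set.Iic b).indicator 1 x := by
  obtain ⟨f, h0, h1, h01⟩ := exists_continuous_zero_one_of_isClosed
    (isClosed_Ici (a := (b : ℝ≥0∞))) (isClosed_Iic (a := (a : ℝ≥0∞)))
    (Set.disjoint_left.2 fun _ hx hx' => (ENNReal.coe_lt_coe.2 hab).not_ge
      (le_trans (Set.mem_Ici.1 hx) hx'))
  refine ⟨f, fun x => ⟨?_, ?_⟩⟩
  · refine Set.indicator_le' (fun y hy => ?_) (fun y _ => (h01 _).1) x
    exact (h1 (show (y : ℝ≥0∞) ≤ a from ENNReal.coe_le_coe.2 hy)).ge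
  · by_cases hx : x ≤ b
    · simpa [Set.indicator_of_mem (Set.mem_Iic.2 hx)] using (h01 x).2
    · rw [Set.indicator_of_notMem (by simpa using hx)]
      exact (h0 (show (b : ℝ≥0∞) ≤ x from ENNReal.coe_le_coe.2 (not_le.1 hx).le)).le

theorem integrable_comp_continuousMap_ennreal {Ω : Type*} [MeasurableSpace Ω] (μ : Measure Ω)
    [IsFiniteMeasure μ] (f : C(ℝ≥0∞, ℝ)) {g : Ω → ℝ≥0∞} (hg : Measurable g) :
    Integrable (fun x => f (g x)) μ :=
  .of_bound (f.continuous.measurable.comp hg).aestronglyMeasurable ‖f‖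
    (.of_forall fun _ => f.norm_coe_le_norm _)

theorem measureReal_Iic_mul_le_integral {a t : ℝ≥0} (ht : 0 < t) (μ : Measure ℝ≥0)
    [IsFiniteMeasure μ] {f : C(ℝ≥0∞, ℝ)}
    (hf : ∀ x : ℝ≥0, (Set.Iic a).indicator 1 x ≤ f x) :
    μ.real (Set.Iic (a * t)) ≤ ∫ x, f ((x / t : ℝ≥0) : ℝ≥0∞) ∂μ := by
  rw [← integral_indicator_one measurableSet_Iic]
  refine integral_mono ((integrable_const (1 : ℝ)).indicator measurableSet_Iic)
    (integrable_comp_continuousMap_ennreal μ f (by fun_prop)) fun x => (le_of_eq ?_).trans (hf _)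
  simp [Set.indicator_apply, div_le_iff₀ ht]

theorem integral_le_measureReal_Iic_mul {b t : ℝ≥0} (ht : 0 < t) (μ : Measure ℝ≥0)
    [IsFiniteMeasure μ] {f : C(ℝ≥0∞, ℝ)}
    (hf : ∀ x : ℝ≥0, f x ≤ (Set.Iic b).indicator 1 x) :
    ∫ x, f ((x / t : ℝ≥0) : ℝ≥0∞) ∂μ ≤ μ.real (Set.Iic (b * t)) := by
  rw [← integral_indicator_one measurableSet_Iic]
  refine integral_mono (integrable_comp_continuousMap_ennreal μ f (by fun_prop))
    ((integrable_const (1 : ℝ)).indicator measurableSet_Iic) fun x => (hf _).trans (le_of_eq ?_)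
  simp [Set.indicator_apply, div_le_iff₀ ht]

/-- Weak convergence implies convergence of quantiles at continuity points. -/
theorem KernelDOA.tendsto_quantile_div {K : Kernel ℝ≥0 ℝ≥0} [IsMarkovKernel K]
    {G : Measure ℝ≥0} [IsProbabilityMeasure G] (h : KernelDOA K G) {u : ℝ} (hu : u < 1)
    (hc : ContinuousAt (quantile G) u) :
    Tendsto (fun t : ℝ≥0 => quantile (K t) u / t) atTop (𝓝 (quantile G u)) := by
  refine tendsto_order.2 ⟨fun a ha => ?_, fun a ha => ?_⟩
  · obtain ⟨b, hab, hb⟩ := exists_between ha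
    obtain ⟨f, hf⟩ := exists_continuousMap_indicator_Iic hab
    have hlt : ∫ x, f (x : ℝ≥0∞) ∂G < u := by
      refine lt_of_le_of_lt ?_ ((lt_quantile_iff G hu b).1 hb)
      simpa using integral_le_measureReal_Iic_mul one_pos G fun x => (hf x).2
    filter_upwards [(h f).eventually (gt_mem_nhds hlt), eventually_gt_atTop 0] with t ht ht0
    rw [lt_div_iff₀ ht0, lt_quantile_iff _ hu]
    exact (measureReal_Iic_mul_le_integral ht0 (K t) fun x => (hf x).1).trans_lt ht
  · obtain ⟨c, hc₀, hca⟩ := exists_between ha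
    obtain ⟨b, hcb, hba⟩ := exists_between hca
    obtain ⟨v, ⟨hvc, hv1⟩, hv⟩ := (((hc.eventually (gt_mem_nhds hc₀)).and
      (gt_mem_nhds hu)).filter_mono nhdsWithin_le_nhds).and
      (self_mem_nhdsWithin (s := Set.Ioi u)) |>.exists
    obtain ⟨f, hf⟩ := exists_continuousMap_indicator_Iic hcb
    have hlt : u < ∫ x, f (x : ℝ≥0∞) ∂G := by
      refine lt_of_lt_of_le hv (((quantile_le_iff G hv1 c).1 hvc.le).trans ?_)
      simpa using measureReal_Iic_mul_le_integral one_pos G fun x => (hf x).1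
    filter_upwards [(h f).eventually (lt_mem_nhds hlt), eventually_gt_atTop 0] with t ht ht0
    refine lt_of_le_of_lt ?_ hba
    rw [div_le_iff₀ ht0, quantile_le_iff _ hu]
    exact ht.le.trans (integral_le_measureReal_Iic_mul ht0 (K t) fun x => (hf x).2)

theorem KernelDOA.of_representation {K : Kernel ℝ≥0 ℝ≥0} {G : Measure ℝ≥0}
    {ξ : ℝ → ℝ≥0} {φ : ℝ≥0 → ℝ → ℝ} (hξ : Measurable ξ) (hφ : Measurable (Function.uncurry φ))
    (hG : Measure.map ξ unifLaw = G)
    (hlim : ∀ u ∈ Set.Icc (0 : ℝ) 1, Tendsto (fun t : ℝ≥0 => φ t u / (t : ℝ)) atTop (𝓝 0))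
    (hK : ∀ y : ℝ≥0,
      Measure.map (fun u => ((ξ u : ℝ) * y + φ y u).toNNReal) unifLaw = K y) :
    KernelDOA K G := by
  intro f
  have : IsProbabilityMeasure unifLaw := ⟨by simp [unifLaw]⟩
  have hmeas (t : ℝ≥0) : Measurable fun u => ((ξ u : ℝ) * t + φ t u).toNNReal :=
    ((hξ.coe_nnreal_real.mul_const _).add (hφ.comp measurable_prodMk_left)).real_toNNReal
  have hf (t : ℝ≥0) : Measurable fun x : ℝ≥0 => f ((x / t : ℝ≥0) : ℝ≥0∞) :=
    f.continuous.measurable.comp (by fun_prop)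
  have hf' : Measurable fun x : ℝ≥0 => f (x : ℝ≥0∞) := f.continuous.measurable.comp (by fun_prop)
  rw [← hG, integral_map hξ.aemeasurable hf'.aestronglyMeasurable]
  simp_rw [← hK, integral_map (hmeas _).aemeasurable (hf _).aestronglyMeasurable]
  refine tendsto_integral_filter_of_dominated_convergence (fun _ => ‖f‖)
    (.of_forall fun t => ((hf t).comp (hmeas t)).aestronglyMeasurable)
    (.of_forall fun t => .of_forall fun u => f.norm_coe_le_norm _) (integrable_const _) ?_
  refine (ae_restrict_iff' measurableSet_Icc).2 (.of_forall fun u hu => ?_)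
  refine (f.continuous.tendsto _).comp (ENNReal.tendsto_coe.2 ?_)
  have hsum : Tendsto (fun t : ℝ≥0 => ((ξ u : ℝ) + φ t u / t).toNNReal) atTop (𝓝 (ξ u)) := by
    simpa using tendsto_real_toNNReal ((hlim u hu).const_add (ξ u : ℝ))
  refine hsum.congr' ?_
  filter_upwards [eventually_gt_atTop 0] with t ht
  have ht' : (t : ℝ) ≠ 0 := by exact_mod_cast ht.ne'
  rw [← Real.toNNReal_coe (r := t), ← Real.toNNReal_div' t.coe_nonneg, Real.toNNReal_coe]
  congr 1
  field_simp

/-- `K ∈ D(G)` iff there exist a random variable `ξ` on the uniform probability space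
`[0,1]` with distribution `G` and a measurable function `φ : [0,∞) × [0,1] → ℝ` with
`φ(t,u)/t → 0` for every `u`, such that `ψ(y,u) = ξ(u)·y + φ(y,u)` is nonnegative and
is an update function corresponding to `K`. -/
theorem kernel_doa_iff_canonical_representation (K : Kernel ℝ≥0 ℝ≥0) [IsMarkovKernel K]
    (G : Measure ℝ≥0) [IsProbabilityMeasure G] :
    KernelDOA K G ↔
      ∃ (ξ : ℝ → ℝ≥0) (φ : ℝ≥0 → ℝ → ℝ),
        Measurable ξ ∧ Measurable (Function.uncurry φ) ∧
        Measure.map ξ unifLaw = G ∧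
        (∀ u ∈ Set.Icc (0:ℝ) 1,
          Tendsto (fun t : ℝ≥0 => φ t u / (t : ℝ)) atTop (𝓝 0)) ∧
        (∀ y : ℝ≥0, ∀ u ∈ Set.Icc (0:ℝ) 1, 0 ≤ (ξ u : ℝ) * y + φ y u) ∧
        (∀ y : ℝ≥0,
          Measure.map (fun u => ((ξ u : ℝ) * y + φ y u).toNNReal) unifLaw = K y) := by
  classical
  refine ⟨fun h => ?_, fun ⟨ξ, φ, hξ, hφ, hG, hlim, _, hK⟩ => .of_representation hξ hφ hG hlim hK⟩
  set N : Set ℝ := insert 1 {u ∈ Set.Iio 1 | ¬ContinuousWithinAt (quantile G) (Set.Iio 1) u}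
  have hN : N.Countable := (monotoneOn_quantile G).countable_not_continuousWithinAt.insert 1
  have hψ (y : ℝ≥0) (u : ℝ) : (quantile G u : ℝ) * y +
      Nᶜ.indicator (fun u => (quantile (K y) u : ℝ) - quantile G u * y) u =
      (if u ∈ N then quantile G u * y else quantile (K y) u : ℝ≥0) := by
    by_cases hu : u ∈ N <;> simp [hu]
  refine ⟨quantile G, fun y => Nᶜ.indicator fun u => (quantile (K y) u : ℝ) - quantile G u * y,
    measurable_quantile G, ?_, map_quantile_unifLaw G, fun u hu => ?_, fun y u _ => ?_, fun y => ?_⟩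
  · have hm : Measurable fun p : ℝ≥0 × ℝ =>
        (quantile (K p.1) p.2 : ℝ) - quantile G p.2 * p.1 :=
      (measurable_quantile_kernel K).coe_nnreal_real.sub
        (((measurable_quantile G).comp measurable_snd).coe_nnreal_real.mul
          measurable_fst.coe_nnreal_real)
    exact hm.indicator (hN.measurableSet.compl.preimage measurable_snd)
  · by_cases huN : u ∈ N
    · simp [huN]
    have hu1 : u < 1 := hu.2.lt_of_ne fun h => huN (h ▸ Set.mem_insert _ _)
    have hc : ContinuousAt (quantile G) u := by
      refine ContinuousWithinAt.continuousAt ?_ (Iio_mem_nhds hu1)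
      by_contra hc
      exact huN (Set.mem_insert_of_mem _ ⟨hu1, hc⟩)
    have hlim := ((NNReal.tendsto_coe.2 (h.tendsto_quantile_div hu1 hc)).sub_const
      (quantile G u : ℝ))
    rw [sub_self] at hlim
    refine hlim.congr' ?_
    filter_upwards [eventually_gt_atTop 0] with t ht
    have ht' : (t : ℝ) ≠ 0 := by exact_mod_cast ht.ne'
    rw [Set.indicator_of_mem huN, NNReal.coe_div]
    field_simp
  · rw [hψ]
    exact NNReal.coe_nonneg _
  · simp_rw [hψ, Real.toNNReal_coe]
    refine (Measure.map_congr ?_).trans (map_quantile_unifLaw (K y))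
    have hae : ∀ᵐ u ∂unifLaw, u ∉ N := ae_restrict_of_ae (hN.ae_notMem _)
    filter_upwards [hae] with u hu
    simp [hu]
end
end

section
/- Suppose the Markov transition kernel K on [0,∞) has an update function in canonical form: ψ(y, (Z,W)) = Z·y + φ(y,W), where Z is a nonnegative random variable, W is a random element of a measurable space, φ is measurable, P[ψ(y,(Z,W)) ∈ A] = K(y,A) for every y ≥ 0 and Borel A, and φ(t,w)/t → 0 as t → ∞ for every w in a set C with P[W ∈ C] = 1. Then K ∈ D(G) with G = P[Z ∈ ·]. -/
open MeasureTheory ProbabilityTheory Filter Topology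
open scoped NNReal ENNReal

noncomputable section

/-- If `g t / t → 0`, then the positive part of `z * t + g t`, divided by `t`, tends to `z`. -/
theorem tendsto_toNNReal_mul_add_div (z : ℝ≥0) {g : ℝ≥0 → ℝ}
    (hg : Tendsto (fun t : ℝ≥0 => g t / (t : ℝ)) atTop (𝓝 0)) :
    Tendsto (fun t : ℝ≥0 => ((z : ℝ) * t + g t).toNNReal / t) atTop (𝓝 z) := by
  have hsum : Tendsto (fun t : ℝ≥0 => ((z : ℝ) + g t / (t : ℝ)).toNNReal) atTop (𝓝 z) := by
    simpa [Function.comp_def] using (continuous_real_toNNReal.tendsto _).comp (hg.const_add (z : ℝ))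
  refine hsum.congr' ?_
  filter_upwards [eventually_gt_atTop 0] with t ht
  have ht' : (0 : ℝ) < t := ht
  rw [show (z : ℝ) + g t / t = (z * t + g t) / t by field_simp,
    Real.toNNReal_div' t.coe_nonneg, Real.toNNReal_coe]

/-- If `K` has an update function in canonical form `ψ(y,(Z,W)) = Z·y + φ(y,W)` with
`φ(t,w)/t → 0` for a.e. `w`, then `K ∈ D(G)` with `G` the law of `Z`. -/
theorem canonical_update_function_doa {Ω E : Type*} [MeasurableSpace Ω] [MeasurableSpace E]
    (P : Measure Ω) [IsProbabilityMeasure P]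
    (K : Kernel ℝ≥0 ℝ≥0) [IsMarkovKernel K]
    (Z : Ω → ℝ≥0) (W : Ω → E) (φ : ℝ≥0 → E → ℝ)
    (hZ : Measurable Z) (hW : Measurable W) (hφ : Measurable (Function.uncurry φ))
    (hpos : ∀ (y : ℝ≥0) (ω : Ω), 0 ≤ (Z ω : ℝ) * y + φ y (W ω))
    (hupd : ∀ y : ℝ≥0,
      Measure.map (fun ω => ((Z ω : ℝ) * y + φ y (W ω)).toNNReal) P = K y)
    (C : Set E) (hC : MeasurableSet C) (hPC : P (W ⁻¹' C) = 1)
    (hφlim : ∀ w ∈ C, Tendsto (fun t : ℝ≥0 => φ t w / (t : ℝ)) atTop (𝓝 0)) :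
    KernelDOA K (P.map Z) := by
  intro f
  have hψ (t : ℝ≥0) : Measurable fun ω => ((Z ω : ℝ) * t + φ t (W ω)).toNNReal :=
    ((hZ.coe_nnreal_real.mul_const _).add (hφ.of_uncurry_left.comp hW)).real_toNNReal
  have hf (t : ℝ≥0) : Measurable fun x : ℝ≥0 => f ((x / t : ℝ≥0) : ℝ≥0∞) :=
    f.continuous.measurable.comp (measurable_id.div_const t).coe_nnreal_ennreal
  have hf' : Measurable fun x : ℝ≥0 => f (x : ℝ≥0∞) :=
    f.continuous.measurable.comp measurable_coe_nnreal_ennreal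
  have hint (t : ℝ≥0) : ∫ x, f ((x / t : ℝ≥0) : ℝ≥0∞) ∂(K t) =
      ∫ ω, f ((((Z ω : ℝ) * t + φ t (W ω)).toNNReal / t : ℝ≥0) : ℝ≥0∞) ∂P := by
    rw [← hupd, integral_map (hψ t).aemeasurable (hf t).aestronglyMeasurable]
  rw [funext hint, integral_map hZ.aemeasurable hf'.aestronglyMeasurable]
  refine tendsto_integral_filter_of_dominated_convergence (fun _ => ‖f‖)
    (Eventually.of_forall fun t => ((hf t).comp (hψ t)).aestronglyMeasurable)
    (Eventually.of_forall fun t => ae_of_all _ fun ω => f.norm_coe_le_norm _)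
    (integrable_const _) ?_
  have hC_ae : ∀ᵐ ω ∂P, ω ∈ W ⁻¹' C := (mem_ae_iff_prob_eq_one (hW hC)).2 hPC
  filter_upwards [hC_ae] with ω hω
  exact (f.continuous.tendsto _).comp
    (ENNReal.tendsto_coe.2 (tendsto_toNNReal_mul_add_div (Z ω) (hφlim _ hω)))
end
end

section
/- Let X be a Markov chain on [0,∞) with transition kernel K ∈ D(G), let m ≥ 1, and let u_t = u(t) be a nonnegative function with u_t → u > 0 as t → ∞. Define the sub-probability measures μ_m^{(t)}(u_t, B) = P_{tu_t}[(X_1/t, …, X_m/t) ∈ B ∩ E'_m] and μ_m(u, B) = P_u[(T*_1, …, T*_m) ∈ B, T*_1 > 0, …, T*_{m-1} > 0], where E'_m = (0,∞]^{m-1} × [0,∞]. Then μ_m^{(t)}(u_t, ·) converges vaguely to μ_m(u, ·) in M_+(E'_m) as t → ∞, i.e., ∫ f dμ_m^{(t)}(u_t,·) → ∫ f dμ_m(u,·) for every continuous f : E'_m → [0,∞) whose support is contained in [a,∞]^{m-1} × [0,∞] for some a > 0. -/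
open MeasureTheory ProbabilityTheory Filter Topology
open scoped NNReal ENNReal

noncomputable section

/-- The law of `(X_1, …, X_m)` for the Markov chain with transition kernel `K`
started from `X_0 = y`. -/
def jointLaw (K : Kernel ℝ≥0 ℝ≥0) : (m : ℕ) → ℝ≥0 → Measure (Fin m → ℝ≥0)
  | 0, _ => Measure.dirac (fun i => i.elim0)
  | m + 1, y => (K y).bind (fun x1 => (jointLaw K m x1).map (Fin.cons x1))

/-- The law of `(T*_1, …, T*_m)` for the tail chain associated with `(G, δ_0)`
started from `T*_0 = u`: `T*_n = u ξ_1 ⋯ ξ_n` with `ξ_i` i.i.d. of law `G`. -/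
def tailChainLaw (G : Measure ℝ≥0) [IsProbabilityMeasure G] (m : ℕ) (u : ℝ≥0) :
    Measure (Fin m → ℝ≥0) :=
  (Measure.pi fun _ : Fin m => G).map
    (fun ξ (i : Fin m) => u * ∏ j ∈ Finset.Iic i, ξ j)

/-- The cone `E'_m = (0,∞]^{m-1} × [0,∞]`: all coordinates except possibly the last
are positive. -/
def Eprime (m : ℕ) : Set (Fin m → ℝ≥0∞) :=
  {x | ∀ i : Fin m, (i : ℕ) + 1 < m → 0 < x i}

/-- Two families of integrable functions that become uniformly close have the same limiting
integrals along a family of probability measures. -/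
lemma tendsto_integral_of_forall_abs_sub_le {ι Ω : Type*} [MeasurableSpace Ω] {l : Filter ι}
    {μ : ι → Measure Ω} [∀ i, IsProbabilityMeasure (μ i)] {A B : ι → Ω → ℝ} {L : ℝ}
    (hA : ∀ i, Integrable (A i) (μ i)) (hB : ∀ i, Integrable (B i) (μ i))
    (hAB : ∀ ε > 0, ∀ᶠ i in l, ∀ ω, |A i ω - B i ω| ≤ ε)
    (hL : Tendsto (fun i => ∫ ω, B i ω ∂(μ i)) l (𝓝 L)) :
    Tendsto (fun i => ∫ ω, A i ω ∂(μ i)) l (𝓝 L) := by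
  have hdiff : Tendsto (fun i => ∫ ω, A i ω ∂(μ i) - ∫ ω, B i ω ∂(μ i)) l (𝓝 0) := by
    rw [Metric.tendsto_nhds]
    intro ε hε
    filter_upwards [hAB (ε / 2) (by positivity)] with i hi
    rw [Real.dist_eq, sub_zero, ← integral_sub (hA i) (hB i)]
    have := norm_integral_le_of_norm_le_const (μ := μ i) (f := fun ω => A i ω - B i ω)
      (C := ε / 2) (ae_of_all _ hi)
    simp only [probReal_univ, mul_one, Real.norm_eq_abs] at this
    linarith
  simpa using hdiff.add hL

/-- The map `x ↦ min (M + 1 - x) 1` on `[0,∞]`: equal to `1` on `[0,M]` and to `0` on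
`[M+1,∞]`. -/
def cutoff (M : ℕ) : C(ℝ≥0∞, ℝ) where
  toFun x := (min ((M + 1 : ℝ≥0∞) - x) 1).toReal
  continuous_toFun := by
    refine ENNReal.continuousOn_toReal.comp_continuous
      ((ENNReal.continuous_sub_left (by finiteness)).min continuous_const) fun x => ?_
    exact ne_top_of_le_ne_top ENNReal.one_ne_top (min_le_right _ _)

lemma cutoff_nonneg (M : ℕ) (x : ℝ≥0∞) : 0 ≤ cutoff M x := ENNReal.toReal_nonneg

lemma cutoff_le_one (M : ℕ) (x : ℝ≥0∞) : cutoff M x ≤ 1 := by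
  have := ENNReal.toReal_mono ENNReal.one_ne_top (min_le_right ((M + 1 : ℝ≥0∞) - x) 1)
  simpa [cutoff] using this

lemma cutoff_eq_zero {M : ℕ} {x : ℝ≥0∞} (hx : (M + 1 : ℝ≥0∞) ≤ x) : cutoff M x = 0 := by
  simp [cutoff, tsub_eq_zero_of_le hx]

lemma cutoff_eq_one {M : ℕ} {x : ℝ≥0∞} (hx : x ≤ M) : cutoff M x = 1 := by
  have h : (1 : ℝ≥0∞) ≤ M + 1 - x :=
    ENNReal.le_sub_of_add_le_left (ne_top_of_le_ne_top (by finiteness) hx) (by gcongr)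
  simp [cutoff, min_eq_right h]

/-- The continuous extension to `[0,∞]` of a function on `[0,∞)` multiplied by a cutoff. -/
def cutoffMul (M : ℕ) (g : C(ℝ≥0, ℝ)) : C(ℝ≥0∞, ℝ) where
  toFun x := cutoff M x * g x.toNNReal
  continuous_toFun := by
    rw [continuous_iff_continuousAt]
    intro x
    by_cases hx : x = ⊤
    · subst hx
      have : (fun x : ℝ≥0∞ => cutoff M x * g x.toNNReal) =ᶠ[𝓝 ⊤] fun _ => 0 := by
        filter_upwards [lt_mem_nhds (show (M + 1 : ℝ≥0∞) < ⊤ by finiteness)] with x hx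
        rw [cutoff_eq_zero hx.le, zero_mul]
      exact continuousAt_const.congr this.symm
    · exact (cutoff M).continuous.continuousAt.mul
        (g.continuous.continuousAt.comp (ENNReal.tendsto_toNNReal hx))

lemma tendsto_integral_cutoff (ν : Measure ℝ≥0) [IsProbabilityMeasure ν] :
    Tendsto (fun M : ℕ => ∫ x, cutoff M (x : ℝ≥0∞) ∂ν) atTop (𝓝 1) := by
  have h : Tendsto (fun M : ℕ => ∫ x, cutoff M (x : ℝ≥0∞) ∂ν) atTop
      (𝓝 (∫ _, (1 : ℝ) ∂ν)) := by
    refine tendsto_integral_of_dominated_convergence (fun _ => 1)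
      (fun M => ((cutoff M).continuous.comp ENNReal.continuous_coe).aestronglyMeasurable)
      (integrable_const _) (fun M => ae_of_all _ fun x => ?_) (ae_of_all _ fun x => ?_)
    · rw [Real.norm_eq_abs, abs_of_nonneg (cutoff_nonneg _ _)]
      exact cutoff_le_one _ _
    · refine tendsto_const_nhds.congr' ?_
      obtain ⟨N, hN⟩ := exists_nat_ge x
      filter_upwards [eventually_ge_atTop N] with M hM
      rw [cutoff_eq_one]
      exact_mod_cast hN.trans (by exact_mod_cast hM)
  simpa using h

/-- Extended continuous mapping theorem: if probability measures on `[0,∞)` converge weakly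
on `[0,∞]` to a probability measure on `[0,∞)`, and uniformly bounded functions converge locally
uniformly on `[0,∞)` to a continuous function, then the integrals converge. -/
lemma tendsto_integral_of_tendstoLocallyUniformly {ι : Type*} {l : Filter ι}
    {μ : ι → Measure ℝ≥0} [∀ i, IsProbabilityMeasure (μ i)]
    {ν : Measure ℝ≥0} [IsProbabilityMeasure ν]
    (hμ : ∀ h : C(ℝ≥0∞, ℝ), Tendsto (fun i => ∫ x, h (x : ℝ≥0∞) ∂(μ i)) l
      (𝓝 (∫ x, h (x : ℝ≥0∞) ∂ν)))
    {g : ι → ℝ≥0 → ℝ} {g₀ : C(ℝ≥0, ℝ)} {C : ℝ}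
    (hgm : ∀ i, Measurable (g i)) (hgC : ∀ i x, |g i x| ≤ C) (hg₀C : ∀ x, |g₀ x| ≤ C)
    (hg : TendstoLocallyUniformly g g₀ l) :
    Tendsto (fun i => ∫ x, g i x ∂(μ i)) l (𝓝 (∫ x, g₀ x ∂ν)) := by
  have hC : 0 ≤ C := (abs_nonneg _).trans (hg₀C 0)
  have hcut : ∀ (ρ : Measure ℝ≥0) [IsProbabilityMeasure ρ] (M : ℕ),
      Integrable (fun x : ℝ≥0 => cutoff M (x : ℝ≥0∞)) ρ := fun ρ _ M =>
    .of_bound ((cutoff M).continuous.comp ENNReal.continuous_coe).aestronglyMeasurable 1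
      (ae_of_all _ fun x => by
        rw [Real.norm_eq_abs, abs_of_nonneg (cutoff_nonneg _ _)]; exact cutoff_le_one _ _)
  -- truncating costs at most `C` times the mass removed by the cutoff
  have htrunc : ∀ (ρ : Measure ℝ≥0) [IsProbabilityMeasure ρ] (M : ℕ) (h : ℝ≥0 → ℝ),
      Measurable h → (∀ x, |h x| ≤ C) →
      |∫ x, h x ∂ρ - ∫ x, cutoff M (x : ℝ≥0∞) * h x ∂ρ| ≤
        C * (1 - ∫ x, cutoff M (x : ℝ≥0∞) ∂ρ) := by
    intro ρ _ M h hm hb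
    have hi : Integrable h ρ := .of_bound hm.aestronglyMeasurable C (ae_of_all _ hb)
    have hci : Integrable (fun x : ℝ≥0 => cutoff M (x : ℝ≥0∞) * h x) ρ :=
      (hcut ρ M).mul_bdd hm.aestronglyMeasurable (ae_of_all _ hb)
    have hr : C * (1 - ∫ x, cutoff M (x : ℝ≥0∞) ∂ρ) =
        ∫ x : ℝ≥0, C * (1 - cutoff M (x : ℝ≥0∞)) ∂ρ := by
      rw [integral_const_mul, integral_sub (integrable_const _) (hcut ρ M)]
      simp
    rw [← integral_sub hi hci, hr, ← Real.norm_eq_abs]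
    refine norm_integral_le_of_norm_le (((integrable_const _).sub (hcut ρ M)).const_mul C)
      (ae_of_all _ fun x => ?_)
    have h1 := cutoff_le_one M x
    rw [Real.norm_eq_abs, ← one_sub_mul, abs_mul, abs_of_nonneg (by linarith), mul_comm C]
    exact mul_le_mul_of_nonneg_left (hb x) (by linarith)
  -- for the truncated functions the convergence is uniform
  have hmid : ∀ M : ℕ, Tendsto (fun i => ∫ x, cutoff M (x : ℝ≥0∞) * g i x ∂(μ i)) l
      (𝓝 (∫ x, cutoff M (x : ℝ≥0∞) * g₀ x ∂ν)) := by
    intro M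
    refine tendsto_integral_of_forall_abs_sub_le
      (B := fun _ (x : ℝ≥0) => cutoff M (x : ℝ≥0∞) * g₀ x)
      (fun i => (hcut _ M).mul_bdd (hgm i).aestronglyMeasurable (ae_of_all _ (hgC i)))
      (fun i => (hcut _ M).mul_bdd g₀.continuous.aestronglyMeasurable (ae_of_all _ hg₀C))
      (fun ε hε => ?_) (hμ (cutoffMul M g₀))
    have hK := (tendstoLocallyUniformlyOn_iff_tendstoUniformlyOn_of_compact
      (isCompact_Icc (a := (0 : ℝ≥0)) (b := M + 1))).1 hg.tendstoLocallyUniformlyOn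
    filter_upwards [Metric.tendstoUniformlyOn_iff.1 hK ε hε] with i hi x
    by_cases hx : x ≤ M + 1
    · have h1 := hi x ⟨zero_le, hx⟩
      rw [dist_comm, Real.dist_eq] at h1
      rw [← mul_sub, abs_mul, abs_of_nonneg (cutoff_nonneg _ _)]
      exact (mul_le_of_le_one_left (abs_nonneg _) (cutoff_le_one _ _)).trans h1.le
    · rw [cutoff_eq_zero (by exact_mod_cast (not_le.1 hx).le)]
      simpa using hε.le
  rw [Metric.tendsto_nhds]
  intro ε hε
  have hC1 : 0 < C + 1 := by linarith
  have hδ : 0 < ε / (4 * (C + 1)) := by positivity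
  obtain ⟨M, hM⟩ := ((tendsto_integral_cutoff ν).eventually
    (lt_mem_nhds (sub_lt_self 1 hδ))).exists
  have key : ∀ (ρ : Measure ℝ≥0), 1 - ε / (4 * (C + 1)) < ∫ x, cutoff M (x : ℝ≥0∞) ∂ρ →
      C * (1 - ∫ x, cutoff M (x : ℝ≥0∞) ∂ρ) ≤ ε / 4 := by
    intro ρ hρ
    calc C * (1 - ∫ x, cutoff M (x : ℝ≥0∞) ∂ρ) ≤ C * (ε / (4 * (C + 1))) := by
          gcongr; linarith
      _ ≤ (C + 1) * (ε / (4 * (C + 1))) := by gcongr; linarith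
      _ = ε / 4 := by field_simp
  filter_upwards [(hμ (cutoff M)).eventually (lt_mem_nhds hM),
    Metric.tendsto_nhds.1 (hmid M) (ε / 4) (by positivity)] with i h1 h2
  have h3 := (htrunc (μ i) M (g i) (hgm i) (hgC i)).trans (key _ h1)
  have h4 := (htrunc ν M g₀ g₀.continuous.measurable hg₀C).trans (key _ hM)
  rw [Real.dist_eq] at h2 ⊢
  rw [abs_le] at h3 h4
  rw [abs_lt] at h2 ⊢
  constructor <;> linarith

lemma ContinuousMap.integrable_comp_of_compactSpace {X Ω : Type*} [TopologicalSpace X]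
    [CompactSpace X] [MeasurableSpace X] [BorelSpace X] [MeasurableSpace Ω] (f : C(X, ℝ))
    {φ : Ω → X} (hφ : Measurable φ) (μ : Measure Ω) [IsFiniteMeasure μ] :
    Integrable (fun ω => f (φ ω)) μ :=
  .of_bound (f.continuous.measurable.comp hφ).aestronglyMeasurable ‖f‖
    (ae_of_all _ fun _ => f.norm_coe_le_norm _)

/-- Joint continuity on a compact space gives uniform convergence. -/
lemma tendstoUniformly_of_forall_tendsto {ι X : Type*} [TopologicalSpace X] [CompactSpace X]
    {l : Filter ι} {F : ι → X → ℝ} {F₀ : X → ℝ} (hF₀ : Continuous F₀)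
    (h : ∀ x, Tendsto (fun p : ι × X => F p.1 p.2) (l ×ˢ 𝓝 x) (𝓝 (F₀ x))) :
    TendstoUniformly F F₀ l := by
  rw [← tendstoLocallyUniformly_iff_tendstoUniformly_of_compactSpace,
    tendstoLocallyUniformly_iff_forall_tendsto]
  intro x
  exact (((hF₀.tendsto x).comp tendsto_snd).prodMk_nhds (h x)).mono_right (nhds_le_uniformity _)

/-- The one-step version: the attraction hypothesis started from `t v` with `v → u > 0`. -/
lemma KernelDOA.tendsto_integral {K : Kernel ℝ≥0 ℝ≥0} [IsMarkovKernel K] {G : Measure ℝ≥0}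
    (hK : KernelDOA K G) {u : ℝ≥0} (hu : 0 < u) (h : C(ℝ≥0∞, ℝ)) :
    Tendsto (fun p : ℝ≥0 × ℝ≥0 => ∫ x, h ((x / p.1 : ℝ≥0) : ℝ≥0∞) ∂(K (p.1 * p.2)))
      (atTop ×ˢ 𝓝 u) (𝓝 (∫ x, h ((u * x : ℝ≥0) : ℝ≥0∞) ∂G)) := by
  have hcont : Continuous fun z : ℝ≥0∞ => (u : ℝ≥0∞) * z :=
    ENNReal.continuous_const_mul ENNReal.coe_ne_top
  have hmeas : ∀ t : ℝ≥0, Measurable fun x : ℝ≥0 => ((x / t : ℝ≥0) : ℝ≥0∞) := by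
    intro t; fun_prop
  have hA : ∀ p : ℝ≥0 × ℝ≥0, Integrable (fun x : ℝ≥0 => h ((x / p.1 : ℝ≥0) : ℝ≥0∞))
      (K (p.1 * p.2)) := fun p => h.integrable_comp_of_compactSpace (hmeas p.1) _
  have hB : ∀ p : ℝ≥0 × ℝ≥0, Integrable
      (fun x : ℝ≥0 => h (u * ((x / (p.1 * p.2) : ℝ≥0) : ℝ≥0∞))) (K (p.1 * p.2)) := fun p =>
    (h.comp ⟨_, hcont⟩).integrable_comp_of_compactSpace (hmeas (p.1 * p.2)) _
  refine tendsto_integral_of_forall_abs_sub_le hA hB ?_ ?_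
  · intro ε hε
    have hunif : TendstoUniformly (fun (v : ℝ≥0) (z : ℝ≥0∞) => h (v * z))
        (fun z => h (u * z)) (𝓝 u) := by
      refine tendstoUniformly_of_forall_tendsto (h.continuous.comp hcont) fun z => ?_
      refine (h.continuous.tendsto _).comp ?_
      refine ENNReal.Tendsto.mul (ENNReal.tendsto_coe.2 tendsto_fst) (Or.inl ?_) tendsto_snd
        (Or.inr ENNReal.coe_ne_top)
      exact_mod_cast hu.ne'
    have h1 := (Metric.tendstoUniformly_iff.1 hunif ε hε).and (lt_mem_nhds hu)
    filter_upwards [(eventually_gt_atTop (0 : ℝ≥0)).prod_mk h1] with p hp x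
    obtain ⟨hp1, hp2, hp3⟩ := hp
    have h2 := hp2 ((x / (p.1 * p.2) : ℝ≥0) : ℝ≥0∞)
    rw [dist_comm, Real.dist_eq] at h2
    have h3 : x / p.1 = p.2 * (x / (p.1 * p.2)) := by
      field_simp
    rw [h3, ENNReal.coe_mul]
    exact h2.le
  · have hlim : Tendsto (fun p : ℝ≥0 × ℝ≥0 => p.1 * p.2) (atTop ×ˢ 𝓝 u) atTop := by
      have : Tendsto (fun p : ℝ≥0 × ℝ≥0 => p.1 * (u / 2)) (atTop ×ˢ 𝓝 u) atTop :=
        (tendsto_id.atTop_mul_const (half_pos hu)).comp tendsto_fst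
      refine tendsto_atTop_mono' _ ?_ this
      filter_upwards [tendsto_snd.eventually (lt_mem_nhds (NNReal.half_lt_self hu.ne'))] with p hp
      gcongr
    have h1 := (hK (h.comp ⟨_, hcont⟩)).comp hlim
    simp only [ENNReal.coe_mul]
    exact h1

lemma measurable_finCons {m : ℕ} :
    Measurable fun p : ℝ≥0 × (Fin m → ℝ≥0) =>
      (Fin.cons p.1 p.2 : Fin (m + 1) → ℝ≥0) := by
  have h : Continuous fun p : ℝ≥0 × (Fin m → ℝ≥0) =>
      (Fin.cons p.1 p.2 : Fin (m + 1) → ℝ≥0) :=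
    Continuous.finCons (A := fun _ => ℝ≥0) continuous_fst continuous_snd
  exact h.measurable

/-- The joint laws of the first `m` steps, bundled as a kernel. -/
def jointKernel (K : Kernel ℝ≥0 ℝ≥0) : (m : ℕ) → Kernel ℝ≥0 (Fin m → ℝ≥0)
  | 0 => Kernel.const _ (Measure.dirac fun i => i.elim0)
  | m + 1 => (Kernel.id ×ₖ jointKernel K m).map (fun p => Fin.cons p.1 p.2) ∘ₖ K

instance (K : Kernel ℝ≥0 ℝ≥0) [IsMarkovKernel K] (m : ℕ) : IsMarkovKernel (jointKernel K m) := by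
  induction m with
  | zero => unfold jointKernel; infer_instance
  | succ m ih =>
    have := Kernel.IsMarkovKernel.map (Kernel.id ×ₖ jointKernel K m) (measurable_finCons (m := m))
    unfold jointKernel
    infer_instance

lemma map_finCons_apply (K : Kernel ℝ≥0 ℝ≥0) [IsMarkovKernel K] (m : ℕ) (y : ℝ≥0) :
    (Kernel.id ×ₖ jointKernel K m).map
      (fun p : ℝ≥0 × (Fin m → ℝ≥0) => (Fin.cons p.1 p.2 : Fin (m + 1) → ℝ≥0)) y =
      (jointKernel K m y).map (Fin.cons y) := by
  rw [Kernel.map_apply _ measurable_finCons, Kernel.prod_apply, Kernel.id_apply,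
    Measure.dirac_prod, Measure.map_map measurable_finCons measurable_prodMk_left]
  rfl

lemma jointKernel_apply (K : Kernel ℝ≥0 ℝ≥0) [IsMarkovKernel K] (m : ℕ) (y : ℝ≥0) :
    jointKernel K m y = jointLaw K m y := by
  induction m generalizing y with
  | zero => rfl
  | succ m ih =>
    rw [jointKernel, jointLaw, Kernel.comp_apply]
    congr 1
    funext x
    rw [map_finCons_apply, ih]

instance (K : Kernel ℝ≥0 ℝ≥0) [IsMarkovKernel K] (m : ℕ) (y : ℝ≥0) :
    IsProbabilityMeasure (jointLaw K m y) := by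
  rw [← jointKernel_apply]; infer_instance

lemma integral_jointLaw_succ (K : Kernel ℝ≥0 ℝ≥0) [IsMarkovKernel K] (m : ℕ) (y : ℝ≥0)
    {F : (Fin (m + 1) → ℝ≥0) → ℝ} (hF : Measurable F)
    (hint : Integrable F (jointLaw K (m + 1) y)) :
    ∫ x, F x ∂(jointLaw K (m + 1) y) =
      ∫ x, ∫ z, F (Fin.cons x z) ∂(jointLaw K m x) ∂(K y) := by
  rw [← jointKernel_apply, jointKernel] at hint ⊢
  rw [Kernel.integral_comp hint]
  refine integral_congr_ae (ae_of_all _ fun x => ?_)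
  simp only
  have hcons : Measurable fun z : Fin m → ℝ≥0 => (Fin.cons x z : Fin (m + 1) → ℝ≥0) :=
    measurable_finCons.comp measurable_prodMk_left
  rw [map_finCons_apply, jointKernel_apply,
    integral_map hcons.aemeasurable hF.aestronglyMeasurable]

lemma integral_pi_succ (G : Measure ℝ≥0) [IsProbabilityMeasure G] (m : ℕ)
    {F : (Fin (m + 1) → ℝ≥0) → ℝ}
    (hint : Integrable F (Measure.pi fun _ => G)) :
    ∫ x, F x ∂(Measure.pi fun _ => G) =
      ∫ x, ∫ z, F (Fin.cons x z) ∂(Measure.pi fun _ : Fin m => G) ∂G := by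
  have h := (measurePreserving_piFinSuccAbove (fun _ : Fin (m + 1) => G) 0).symm
  rw [← h.integral_comp' (g := F), integral_prod]
  · have he : ∀ x z, (MeasurableEquiv.piFinSuccAbove (fun _ : Fin (m + 1) => ℝ≥0) 0).symm (x, z) =
        Fin.cons x z := fun x z => by
      rw [← Fin.insertNth_zero']; rfl
    simp only [he]
  · exact (h.integrable_comp_emb (MeasurableEquiv.measurableEmbedding _)).2 hint

lemma cons_mul_prod_Iic {m : ℕ} (u x : ℝ≥0) (z : Fin m → ℝ≥0) :
    (fun i : Fin (m + 1) => ((u * ∏ j ∈ Finset.Iic i, (Fin.cons x z : Fin (m + 1) → ℝ≥0) j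
      : ℝ≥0) : ℝ≥0∞)) =
    Fin.cons ((u * x : ℝ≥0) : ℝ≥0∞)
      (fun i => ((u * x * ∏ j ∈ Finset.Iic i, z j : ℝ≥0) : ℝ≥0∞)) := by
  funext i
  refine Fin.cases ?_ (fun i => ?_) i
  · have : Finset.Iic (0 : Fin (m + 1)) = {0} := by ext j; simp
    simp [this]
  · have : Finset.Iic i.succ = insert 0 ((Finset.Iic i).map (Fin.succEmb m)) := by
      ext j
      refine Fin.cases ?_ (fun j => ?_) j <;> simp
    rw [this, Finset.prod_insert (by simp), Finset.prod_map]
    simp [mul_assoc]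

/-- The finite-dimensional convergence, jointly in the level `t → ∞` and the starting point
`v → u`. -/
lemma tendsto_integral_jointLaw {K : Kernel ℝ≥0 ℝ≥0} [IsMarkovKernel K]
    {G : Measure ℝ≥0} [IsProbabilityMeasure G] (hK : KernelDOA K G) (m : ℕ)
    {u : ℝ≥0} (hu : 0 < u ∨ m = 0) {a : ℝ≥0∞} (ha : 0 < a)
    (f : C((Fin m → ℝ≥0∞), ℝ))
    (hf : ∀ x, f x ≠ 0 → ∀ i : Fin m, (i : ℕ) + 1 < m → a ≤ x i) :
    Tendsto (fun p : ℝ≥0 × ℝ≥0 =>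
        ∫ x, f (fun i => ((x i / p.1 : ℝ≥0) : ℝ≥0∞)) ∂(jointLaw K m (p.1 * p.2)))
      (atTop ×ˢ 𝓝 u)
      (𝓝 (∫ ξ, f (fun i => ((u * ∏ j ∈ Finset.Iic i, ξ j : ℝ≥0) : ℝ≥0∞))
        ∂(Measure.pi fun _ : Fin m => G))) := by
  induction m generalizing u with
  | zero =>
    have h : ∀ x y : Fin 0 → ℝ≥0∞, f x = f y := fun x y => by rw [Subsingleton.elim x y]
    simp only [h _ default, integral_const, probReal_univ]
    exact tendsto_const_nhds
  | succ m ih =>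
    have hu : 0 < u := by simpa using hu
    have hscale : ∀ (n : ℕ) (t : ℝ≥0), Measurable fun (x : Fin n → ℝ≥0) (i : Fin n) =>
        ((x i / t : ℝ≥0) : ℝ≥0∞) := fun n t => by fun_prop
    have hprod : Continuous fun q : ℝ≥0 × (Fin m → ℝ≥0) =>
        (Fin.cons (q.1 : ℝ≥0∞) (fun i => ((q.1 * ∏ j ∈ Finset.Iic i, q.2 j : ℝ≥0) : ℝ≥0∞)) :
          Fin (m + 1) → ℝ≥0∞) := by
      refine Continuous.finCons (by fun_prop) ?_
      refine continuous_pi fun i => ENNReal.continuous_coe.comp ?_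
      fun_prop
    have hcons : Continuous fun q : ℝ≥0 × (Fin m → ℝ≥0∞) =>
        (Fin.cons (q.1 : ℝ≥0∞) q.2 : Fin (m + 1) → ℝ≥0∞) :=
      (ENNReal.continuous_coe.comp continuous_fst).finCons continuous_snd
    -- the conditional expectation given the first step, and its limit
    let g : ℝ≥0 → ℝ≥0 → ℝ := fun t x => ∫ z, f (Fin.cons (x : ℝ≥0∞)
      (fun i => ((z i / t : ℝ≥0) : ℝ≥0∞))) ∂(jointLaw K m (t * x))
    let g₀ : C(ℝ≥0, ℝ) :=
      { toFun := fun x => ∫ ξ, f (Fin.cons (x : ℝ≥0∞)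
          (fun i => ((x * ∏ j ∈ Finset.Iic i, ξ j : ℝ≥0) : ℝ≥0∞)))
            ∂(Measure.pi fun _ : Fin m => G)
        continuous_toFun := by
          refine continuous_of_dominated (bound := fun _ => ‖f‖) (fun x => ?_)
            (fun x => ae_of_all _ fun _ => f.norm_coe_le_norm _) (integrable_const _)
            (ae_of_all _ fun ξ => ?_)
          · exact ((f.continuous.comp hprod).comp (.prodMk_right x)).aestronglyMeasurable
          · exact (f.continuous.comp hprod).comp (.prodMk_left ξ) }
    have hgm : ∀ t, Measurable (g t) := by
      intro t
      have hm : Measurable fun q : ℝ≥0 × (Fin m → ℝ≥0) =>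
          f (Fin.cons (q.1 : ℝ≥0∞) (fun i => ((q.2 i / t : ℝ≥0) : ℝ≥0∞))) :=
        (f.continuous.comp hcons).measurable.comp
          (measurable_fst.prodMk ((hscale m t).comp measurable_snd))
      have h1 := hm.stronglyMeasurable.integral_kernel_prod_right'
        (κ := (jointKernel K m).comap (fun x => t * x) (by fun_prop))
      simpa only [Kernel.comap_apply, jointKernel_apply] using h1.measurable
    have hgC : ∀ t x, |g t x| ≤ ‖f‖ := fun t x => by
      have := norm_integral_le_of_norm_le_const (μ := jointLaw K m (t * x))
        (ae_of_all _ fun z => f.norm_coe_le_norm (Fin.cons (x : ℝ≥0∞)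
          (fun i => ((z i / t : ℝ≥0) : ℝ≥0∞))))
      simpa using this
    have hg₀C : ∀ x, |g₀ x| ≤ ‖f‖ := fun x => by
      have := norm_integral_le_of_norm_le_const (μ := Measure.pi fun _ : Fin m => G)
        (ae_of_all _ fun ξ => f.norm_coe_le_norm (Fin.cons (x : ℝ≥0∞)
          (fun i => ((x * ∏ j ∈ Finset.Iic i, ξ j : ℝ≥0) : ℝ≥0∞))))
      rw [probReal_univ, mul_one] at this
      exact this
    have hjoint : ∀ x₀, Tendsto (fun q : ℝ≥0 × ℝ≥0 => g q.1 q.2) (atTop ×ˢ 𝓝 x₀)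
        (𝓝 (g₀ x₀)) := by
      intro x₀
      by_cases hx₀ : 0 < x₀ ∨ m = 0
      · let f₀ : C((Fin m → ℝ≥0∞), ℝ) := f.comp ⟨_, hcons.comp (.prodMk_right x₀)⟩
        have hf₀ : ∀ x, f₀ x ≠ 0 → ∀ i : Fin m, (i : ℕ) + 1 < m → a ≤ x i := fun x hx i hi => by
          simpa using hf (Fin.cons (x₀ : ℝ≥0∞) x) hx i.succ (by simpa using hi)
        refine tendsto_integral_of_forall_abs_sub_le
          (fun q => f.integrable_comp_of_compactSpace
            ((hcons.comp (.prodMk_right q.2)).measurable.comp (hscale m q.1)) _)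
          (fun q => f₀.integrable_comp_of_compactSpace (hscale m q.1) _) (fun ε hε => ?_)
          (ih hx₀ f₀ hf₀)
        have hunif : TendstoUniformly (fun (v : ℝ≥0) w => f (Fin.cons (v : ℝ≥0∞) w)) f₀
            (𝓝 x₀) := by
          refine tendstoUniformly_of_forall_tendsto f₀.continuous fun w => ?_
          rw [← nhds_prod_eq]
          exact (f.continuous.comp hcons).tendsto (x₀, w)
        filter_upwards [tendsto_snd.eventually (Metric.tendstoUniformly_iff.1 hunif ε hε)]
          with q hq z
        have h2 := hq (fun i => ((z i / q.1 : ℝ≥0) : ℝ≥0∞))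
        rw [dist_comm, Real.dist_eq] at h2
        exact h2.le
      · push Not at hx₀
        obtain ⟨hx₀, hm⟩ := hx₀
        obtain rfl : x₀ = 0 := le_antisymm hx₀ zero_le
        have hz : ∀ (x : ℝ≥0) (w : Fin m → ℝ≥0∞), (x : ℝ≥0∞) < a →
            f (Fin.cons (x : ℝ≥0∞) w) = 0 := by
          intro x w hx
          by_contra hne
          refine absurd (hf _ hne 0 (by simpa using Nat.pos_of_ne_zero hm)) ?_
          simpa using hx
        have h0 : g₀ 0 = 0 := by
          simp only [g₀, ContinuousMap.coe_mk]
          rw [integral_congr_ae (g := fun _ => 0)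
            (ae_of_all _ fun ξ => hz 0 _ (by simpa using ha)), integral_zero]
        rw [h0]
        refine tendsto_const_nhds.congr' ?_
        have hlt : ∀ᶠ x : ℝ≥0 in 𝓝 0, (x : ℝ≥0∞) < a :=
          ENNReal.continuous_coe.continuousAt.eventually_lt continuousAt_const (by simpa using ha)
        filter_upwards [tendsto_snd.eventually hlt] with q hq
        simp only [g]
        rw [integral_congr_ae (g := fun _ => 0) (ae_of_all _ fun z => hz q.2 _ hq), integral_zero]
    let μ : ℝ≥0 × ℝ≥0 → Measure ℝ≥0 := fun p => (K (p.1 * p.2)).map (fun x => x / p.1)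
    let ν : Measure ℝ≥0 := G.map (fun x => u * x)
    have hdiv : ∀ t : ℝ≥0, Measurable fun x : ℝ≥0 => x / t := fun t => by fun_prop
    have hmul : Measurable fun x : ℝ≥0 => u * x := by fun_prop
    have : ∀ p, IsProbabilityMeasure (μ p) := fun p =>
      Measure.isProbabilityMeasure_map (hdiv _).aemeasurable
    have : IsProbabilityMeasure ν := Measure.isProbabilityMeasure_map hmul.aemeasurable
    have hμ : ∀ h : C(ℝ≥0∞, ℝ), Tendsto (fun p => ∫ x, h (x : ℝ≥0∞) ∂(μ p)) (atTop ×ˢ 𝓝 u)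
        (𝓝 (∫ x, h (x : ℝ≥0∞) ∂ν)) := by
      intro h
      have hh : Continuous fun x : ℝ≥0 => h (x : ℝ≥0∞) :=
        h.continuous.comp ENNReal.continuous_coe
      simp only [μ, ν]
      rw [integral_map hmul.aemeasurable hh.aestronglyMeasurable]
      simp_rw [integral_map (hdiv _).aemeasurable hh.aestronglyMeasurable]
      exact hK.tendsto_integral hu h
    have hloc : TendstoLocallyUniformly (fun p : ℝ≥0 × ℝ≥0 => g p.1) g₀ (atTop ×ˢ 𝓝 u) := by
      rw [tendstoLocallyUniformly_iff_forall_tendsto]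
      intro x₀
      exact (((g₀.continuous.tendsto x₀).comp tendsto_snd).prodMk_nhds
        ((hjoint x₀).comp (tendsto_fst.prodMap tendsto_id))).mono_right (nhds_le_uniformity _)
    have hmain := tendsto_integral_of_tendstoLocallyUniformly hμ (fun p => hgm p.1)
      (fun p => hgC p.1) hg₀C hloc
    have hlim : ∫ x, g₀ x ∂ν = ∫ ξ, f (fun i => ((u * ∏ j ∈ Finset.Iic i, ξ j : ℝ≥0) : ℝ≥0∞))
        ∂(Measure.pi fun _ : Fin (m + 1) => G) := by
      rw [integral_pi_succ]
      · simp only [cons_mul_prod_Iic, ν]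
        rw [integral_map hmul.aemeasurable g₀.continuous.aestronglyMeasurable]
        rfl
      · refine f.integrable_comp_of_compactSpace ?_ _
        fun_prop
    rw [← hlim]
    refine hmain.congr' ?_
    filter_upwards [tendsto_fst.eventually (eventually_gt_atTop (0 : ℝ≥0))] with p hp
    rw [integral_jointLaw_succ K m _
      (F := fun x => f (fun i => ((x i / p.1 : ℝ≥0) : ℝ≥0∞)))
      (f.continuous.measurable.comp (hscale _ _))
      (f.integrable_comp_of_compactSpace (hscale _ _) _)]
    simp only [μ]
    rw [integral_map (hdiv _).aemeasurable (hgm _).aestronglyMeasurable]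
    refine integral_congr_ae (ae_of_all _ fun x => ?_)
    simp only [g]
    rw [mul_div_cancel₀ x hp.ne']
    refine integral_congr_ae (ae_of_all _ fun z => ?_)
    simp only
    congr 1
    funext i
    refine Fin.cases ?_ (fun i => ?_) i <;> simp

/-- Conditional on `X_0 = t u_t` with `u_t → u > 0`, the laws of `(X_1/t, …, X_m/t)`
restricted to `E'_m = (0,∞]^{m-1} × [0,∞]` converge vaguely in `M_+(E'_m)` to the law of
the tail chain `(T*_1, …, T*_m)` started from `u`, restricted to `E'_m`:  tested against
continuous nonnegative `f` supported in `[a,∞]^{m-1} × [0,∞]` for some `a > 0`. -/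
theorem fdd_vague_convergence_Eprime (K : Kernel ℝ≥0 ℝ≥0) [IsMarkovKernel K]
    (G : Measure ℝ≥0) [IsProbabilityMeasure G] (hK : KernelDOA K G)
    (m : ℕ) (hm : 1 ≤ m)
    (u : ℝ≥0) (hu : 0 < u) (ut : ℝ≥0 → ℝ≥0) (hut : Tendsto ut atTop (𝓝 u))
    (f : C((Fin m → ℝ≥0∞), ℝ)) (hf0 : ∀ x, 0 ≤ f x)
    (hfsupp : ∃ a : ℝ≥0∞, 0 < a ∧ ∀ x : Fin m → ℝ≥0∞, f x ≠ 0 →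
      ∀ i : Fin m, (i : ℕ) + 1 < m → a ≤ x i) :
    Tendsto (fun t : ℝ≥0 =>
        ∫ x, f x ∂(((jointLaw K m (t * ut t)).map
          (fun x (i : Fin m) => ((x i / t : ℝ≥0) : ℝ≥0∞))).restrict (Eprime m)))
      atTop
      (𝓝 (∫ x, f x ∂(((tailChainLaw G m u).map
          (fun x (i : Fin m) => (x i : ℝ≥0∞))).restrict (Eprime m)))) := by
  obtain ⟨a, ha, hf⟩ := hfsupp
  have hzero : ∀ x ∉ Eprime m, f x = 0 := by
    intro x hx
    by_contra hne
    exact hx fun i hi => ha.trans_le (hf x hne i hi)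
  simp only [setIntegral_eq_integral_of_forall_compl_eq_zero hzero, tailChainLaw]
  have hscale : ∀ t : ℝ≥0, Measurable fun (x : Fin m → ℝ≥0) (i : Fin m) =>
      ((x i / t : ℝ≥0) : ℝ≥0∞) := fun t => by fun_prop
  have hcoe : Measurable fun (x : Fin m → ℝ≥0) (i : Fin m) => (x i : ℝ≥0∞) := by fun_prop
  have hprod : Measurable fun (ξ : Fin m → ℝ≥0) (i : Fin m) =>
      u * ∏ j ∈ Finset.Iic i, ξ j := by fun_prop
  rw [Measure.map_map hcoe hprod, integral_map (hcoe.comp hprod).aemeasurable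
    f.continuous.aestronglyMeasurable]
  simp_rw [integral_map (hscale _).aemeasurable f.continuous.aestronglyMeasurable]
  exact (tendsto_integral_jointLaw hK m (Or.inl hu) ha f hf).comp (tendsto_id.prodMk hut)
end
end

section
/- Suppose the Markov transition kernel K on [0,∞) has an update function in canonical form ψ(y,(Z,W)) = Z·y + φ(y,W) with φ(t,w)/t → 0 as t → ∞ for every w in a set C with P[W ∈ C] = 1 (so that K ∈ D(G) with G the law of Z). If ζ(t) > 0 is a function on [0,∞) such that φ(t,w)/ζ(t) → 0 as t → ∞ for every w in a set B with P[W ∈ B] = 1, then liminf_{t→∞} K(t, [0, ζ(t)]) ≥ G({0}). If in addition ζ(t)/t → 0 as t → ∞, then γ(t) := ζ(t)/t is an extremal boundary for K. -/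
open MeasureTheory ProbabilityTheory Filter Topology
open scoped NNReal ENNReal

noncomputable section

/-- An extremal boundary for `K` (relative to the limit distribution `G`): a function
`γ` with `γ(t) → 0` and `K(t, t[0,γ(t)]) → G({0})` as `t → ∞`. -/
def ExtremalBoundary (K : Kernel ℝ≥0 ℝ≥0) (G : Measure ℝ≥0) (γ : ℝ≥0 → ℝ≥0) : Prop :=
  Tendsto γ atTop (𝓝 0) ∧
    Tendsto (fun t : ℝ≥0 => (K t) (Set.Iic (t * γ t))) atTop (𝓝 (G {0}))

theorem ae_mem_of_measure_preimage_eq_one {Ω E : Type*} [MeasurableSpace Ω] [MeasurableSpace E]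
    {P : Measure Ω} [IsProbabilityMeasure P] {W : Ω → E} (hW : Measurable W) {B : Set E}
    (hB : MeasurableSet B) (hPB : P (W ⁻¹' B) = 1) : ∀ᵐ ω ∂P, W ω ∈ B :=
  (mem_ae_iff_prob_eq_one (hW hB)).2 hPB

theorem eventually_le_of_tendsto_div_zero {α : Type*} {l : Filter α} {f : α → ℝ} {g : α → ℝ≥0}
    (hg : ∀ t, 0 < g t) (h : Tendsto (fun t => f t / (g t : ℝ)) l (𝓝 0)) :
    ∀ᶠ t in l, f t ≤ g t := by
  filter_upwards [h.eventually_le_const one_pos] with t ht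
  have hgt : (0 : ℝ) < g t := by exact_mod_cast hg t
  simpa using (div_le_iff₀ hgt).1 ht

theorem eventually_lt_mul_add {z : ℝ≥0} (hz : 0 < z) {f : ℝ≥0 → ℝ} {ζ : ℝ≥0 → ℝ≥0}
    (hf : Tendsto (fun t : ℝ≥0 => f t / (t : ℝ)) atTop (𝓝 0))
    (hζ : Tendsto (fun t : ℝ≥0 => ζ t / t) atTop (𝓝 0)) :
    ∀ᶠ t : ℝ≥0 in atTop, (ζ t : ℝ) < z * t + f t := by
  have hz' : (0 : ℝ) < z := by exact_mod_cast hz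
  have hζ' : Tendsto (fun t : ℝ≥0 => (ζ t : ℝ) / (t : ℝ)) atTop (𝓝 0) := by
    simpa using NNReal.tendsto_coe.2 hζ
  have h := hζ'.sub hf
  rw [sub_zero] at h
  filter_upwards [h.eventually_lt_const hz', eventually_gt_atTop 0] with t ht h0
  have ht0 : (0 : ℝ) < t := by exact_mod_cast h0
  rw [← sub_div, div_lt_iff₀ ht0] at ht
  linarith

/-- If `K` has an update function in canonical form `ψ(y,(Z,W)) = Z·y + φ(y,W)` (so that
`K ∈ D(G)` with `G` the law of `Z`), and `ζ(t) > 0` satisfies `φ(t,w)/ζ(t) → 0` a.s.,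
then `liminf_{t→∞} K(t,[0,ζ(t)]) ≥ G({0})`; if moreover `ζ(t)/t → 0`, then
`γ(t) = ζ(t)/t` is an extremal boundary for `K`. -/
theorem update_function_extremal_boundary {Ω E : Type*} [MeasurableSpace Ω]
    [MeasurableSpace E] (P : Measure Ω) [IsProbabilityMeasure P]
    (K : Kernel ℝ≥0 ℝ≥0) [IsMarkovKernel K]
    (Z : Ω → ℝ≥0) (W : Ω → E) (φ : ℝ≥0 → E → ℝ)
    (hZ : Measurable Z) (hW : Measurable W) (hφ : Measurable (Function.uncurry φ))
    (hpos : ∀ (y : ℝ≥0) (ω : Ω), 0 ≤ (Z ω : ℝ) * y + φ y (W ω))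
    (hupd : ∀ y : ℝ≥0,
      Measure.map (fun ω => ((Z ω : ℝ) * y + φ y (W ω)).toNNReal) P = K y)
    (C : Set E) (hC : MeasurableSet C) (hPC : P (W ⁻¹' C) = 1)
    (hφlim : ∀ w ∈ C, Tendsto (fun t : ℝ≥0 => φ t w / (t : ℝ)) atTop (𝓝 0))
    (ζ : ℝ≥0 → ℝ≥0) (hζpos : ∀ t, 0 < ζ t)
    (B : Set E) (hB : MeasurableSet B) (hPB : P (W ⁻¹' B) = 1)
    (hφζ : ∀ w ∈ B, Tendsto (fun t : ℝ≥0 => φ t w / (ζ t : ℝ)) atTop (𝓝 0)) :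
    (P.map Z) {0} ≤ Filter.liminf (fun t : ℝ≥0 => (K t) (Set.Iic (ζ t))) atTop ∧
    (Tendsto (fun t : ℝ≥0 => ζ t / t) atTop (𝓝 0) →
      ExtremalBoundary K (P.map Z) (fun t => ζ t / t)) := by
  have hψ : ∀ t : ℝ≥0, Measurable fun ω => ((Z ω : ℝ) * t + φ t (W ω)).toNNReal := fun t => by
    have : Measurable fun ω => φ t (W ω) := hφ.comp (measurable_const.prodMk hW)
    fun_prop
  have hK : ∀ t : ℝ≥0, K t (Set.Iic (ζ t)) =
      P {ω | (Z ω : ℝ) * t + φ t (W ω) ≤ ζ t} := fun t => by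
    rw [← hupd t, Measure.map_apply (hψ t) measurableSet_Iic]
    congr 1
    ext ω
    simp [Real.toNNReal_le_iff_le_coe]
  have hmeas : ∀ t : ℝ≥0, MeasurableSet {ω | (Z ω : ℝ) * t + φ t (W ω) ≤ ζ t} := fun t => by
    convert hψ t (measurableSet_Iic (a := ζ t)) using 1
    ext ω
    simp [Real.toNNReal_le_iff_le_coe]
  have hZ0 : MeasurableSet (Z ⁻¹' {0}) := hZ (measurableSet_singleton 0)
  have hBae := ae_mem_of_measure_preimage_eq_one hW hB hPB
  have hCae := ae_mem_of_measure_preimage_eq_one hW hC hPC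
  rw [Measure.map_apply hZ (measurableSet_singleton 0)]
  have hin : ∀ ω, W ω ∈ B → Z ω = 0 →
      ∀ᶠ t : ℝ≥0 in atTop, (Z ω : ℝ) * t + φ t (W ω) ≤ ζ t := fun ω hω h0 => by
    simpa [h0] using eventually_le_of_tendsto_div_zero hζpos (hφζ _ hω)
  constructor
  · have hlim : Tendsto
        (fun t : ℝ≥0 => P (Z ⁻¹' {0} ∩ {ω | (Z ω : ℝ) * t + φ t (W ω) ≤ ζ t})) atTop
        (𝓝 (P (Z ⁻¹' {0}))) := by
      refine tendsto_measure_of_ae_tendsto_indicator_of_isFiniteMeasure atTop hZ0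
        (fun t => hZ0.inter (hmeas t)) ?_
      filter_upwards [hBae] with ω hω
      by_cases h0 : Z ω = 0
      · filter_upwards [hin ω hω h0] with t ht
        exact ⟨fun h => h.1, fun h => ⟨h, ht⟩⟩
      · exact Eventually.of_forall fun t => ⟨fun h => h.1, fun h => (h0 h).elim⟩
    rw [← hlim.liminf_eq]
    refine liminf_le_liminf (Eventually.of_forall fun t => ?_)
    rw [hK]
    exact measure_mono Set.inter_subset_right
  · intro hζt
    refine ⟨hζt, ?_⟩
    rw [Measure.map_apply hZ (measurableSet_singleton 0)]
    have hlim : Tendsto (fun t : ℝ≥0 => P {ω | (Z ω : ℝ) * t + φ t (W ω) ≤ ζ t}) atTop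
        (𝓝 (P (Z ⁻¹' {0}))) := by
      refine tendsto_measure_of_ae_tendsto_indicator_of_isFiniteMeasure atTop hZ0 hmeas ?_
      filter_upwards [hBae, hCae] with ω hωB hωC
      by_cases h0 : Z ω = 0
      · filter_upwards [hin ω hωB h0] with t ht
        exact ⟨fun _ => h0, fun _ => ht⟩
      · filter_upwards [eventually_lt_mul_add (pos_iff_ne_zero.2 h0) (hφlim _ hωC) hζt] with t ht
        exact ⟨fun h => (ht.not_ge h).elim, fun h => (h0 h).elim⟩
    refine hlim.congr' ?_
    filter_upwards [eventually_gt_atTop 0] with t ht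
    rw [← hK, mul_div_cancel₀ _ ht.ne']
end
end

section
/- If K ∈ D(G), then there exists a uniform extremal boundary for K: a function γ* : [0,∞) → [0,∞) with γ*(t) → 0 as t → ∞ such that K(tu_t, t[0, γ*(t)]) → G({0}) as t → ∞ for every nonnegative function u_t = u(t) with u_t → u for some u > 0. -/
open MeasureTheory ProbabilityTheory Filter Topology
open scoped NNReal ENNReal

noncomputable section

/-- A countable family of eventually true properties admits a diagonal index tending to infinity. -/
theorem exists_tendsto_atTop_eventually_diagonal (P : ℕ → ℝ≥0 → Prop)
    (hP : ∀ n, ∀ᶠ t in atTop, P n t) :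
    ∃ N : ℝ≥0 → ℕ, Tendsto N atTop atTop ∧ ∀ᶠ t in atTop, P (N t) t := by
  classical
  refine ⟨fun t => Nat.findGreatest (fun n => P n t) ⌊t⌋₊, ?_, ?_⟩
  · refine tendsto_atTop.2 fun m => ?_
    filter_upwards [hP m, eventually_ge_atTop (m : ℝ≥0)] with t ht htm
    exact Nat.le_findGreatest (Nat.le_floor htm) ht
  · filter_upwards [hP 0] with t ht
    exact Nat.findGreatest_spec (P := fun n => P n t) (Nat.zero_le _) ht

/-- The rescaled law of a transition kernel, on the compactified half-line. -/
def rescaledLaw (K : Kernel ℝ≥0 ℝ≥0) [IsMarkovKernel K] (t : ℝ≥0) :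
    ProbabilityMeasure ℝ≥0∞ :=
  ⟨(K t).map fun x => ((x / t : ℝ≥0) : ℝ≥0∞),
    Measure.isProbabilityMeasure_map (by fun_prop)⟩

/-- A probability measure on the half-line, seen on the compactified half-line. -/
def compactifiedLaw (G : Measure ℝ≥0) [IsProbabilityMeasure G] : ProbabilityMeasure ℝ≥0∞ :=
  ⟨G.map fun x : ℝ≥0 => (x : ℝ≥0∞), Measure.isProbabilityMeasure_map (by fun_prop)⟩

theorem KernelDOA.tendsto_rescaledLaw {K : Kernel ℝ≥0 ℝ≥0} [IsMarkovKernel K]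
    {G : Measure ℝ≥0} [IsProbabilityMeasure G] (hK : KernelDOA K G) :
    Tendsto (rescaledLaw K) atTop (𝓝 (compactifiedLaw G)) := by
  rw [ProbabilityMeasure.tendsto_iff_forall_integral_tendsto]
  intro f
  have hf {μ : Measure ℝ≥0∞} : AEStronglyMeasurable f μ :=
    f.continuous.measurable.aestronglyMeasurable
  have hl (t : ℝ≥0) : ∫ x, f x ∂(rescaledLaw K t : Measure ℝ≥0∞) =
      ∫ x, f ((x / t : ℝ≥0) : ℝ≥0∞) ∂(K t) :=
    integral_map (by fun_prop) hf
  have hr : ∫ x, f x ∂(compactifiedLaw G : Measure ℝ≥0∞) = ∫ x, f (x : ℝ≥0∞) ∂G :=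
    integral_map (by fun_prop) hf
  simp only [hl, hr]
  exact hK f.toContinuousMap

theorem KernelDOA.eventually_measure_Iic_lt {K : Kernel ℝ≥0 ℝ≥0} [IsMarkovKernel K]
    {G : Measure ℝ≥0} [IsProbabilityMeasure G] (hK : KernelDOA K G) {ε : ℝ≥0} {c : ℝ≥0∞}
    (hc : G (Set.Iic ε) < c) : ∀ᶠ s in atTop, K s (Set.Iic (s * ε)) < c := by
  have h := ProbabilityMeasure.limsup_measure_closed_le_of_tendsto hK.tendsto_rescaledLaw
    (isClosed_Iic (a := (ε : ℝ≥0∞)))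
  have hG : (compactifiedLaw G : Measure ℝ≥0∞) (Set.Iic (ε : ℝ≥0∞)) = G (Set.Iic ε) := by
    refine (Measure.map_apply (by fun_prop) measurableSet_Iic).trans (congrArg G ?_)
    ext x
    simp
  rw [hG] at h
  filter_upwards [eventually_lt_of_limsup_lt (h.trans_lt hc), eventually_gt_atTop 0] with s hs h0
  refine lt_of_eq_of_lt ?_ hs
  refine Eq.trans (congrArg (K s) ?_)
    (Measure.map_apply (by fun_prop) measurableSet_Iic).symm
  ext x
  simp only [Set.mem_Iic, Set.mem_preimage, ENNReal.coe_le_coe]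
  rw [div_le_iff₀' h0]

theorem KernelDOA.eventually_lt_measure_Iic {K : Kernel ℝ≥0 ℝ≥0} [IsMarkovKernel K]
    {G : Measure ℝ≥0} [IsProbabilityMeasure G] (hK : KernelDOA K G) {ε : ℝ≥0} (hε : 0 < ε)
    {c : ℝ≥0∞} (hc : c < G {0}) : ∀ᶠ s in atTop, c < K s (Set.Iic (s * ε)) := by
  have h := ProbabilityMeasure.le_liminf_measure_open_of_tendsto hK.tendsto_rescaledLaw
    (isOpen_Iio (a := (ε : ℝ≥0∞)))
  have hG : G {0} ≤ (compactifiedLaw G : Measure ℝ≥0∞) (Set.Iio (ε : ℝ≥0∞)) := by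
    refine le_of_le_of_eq (measure_mono ?_)
      (Measure.map_apply (by fun_prop) measurableSet_Iio).symm
    simpa using hε
  filter_upwards [eventually_lt_of_lt_liminf (hc.trans_le (hG.trans h)),
    eventually_gt_atTop 0] with s hs h0
  refine hs.trans_le (le_of_eq_of_le (Measure.map_apply (by fun_prop) measurableSet_Iio)
    (measure_mono fun x hx => ?_))
  simp only [Set.mem_preimage, Set.mem_Iio, ENNReal.coe_lt_coe] at hx
  exact (div_le_iff₀' h0).1 hx.le

theorem tendsto_inv_natCast_add_one_nnreal :
    Tendsto (fun n : ℕ => ((n : ℝ≥0) + 1)⁻¹) atTop (𝓝 0) := by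
  simpa using tendsto_one_div_add_atTop_nhds_zero_nat (𝕜 := ℝ≥0)

theorem exists_pos_measure_Iic_lt {G : Measure ℝ≥0} [IsFiniteMeasure G] {c : ℝ≥0∞}
    (hc : G {0} < c) : ∃ ε : ℝ≥0, 0 < ε ∧ G (Set.Iic ε) < c := by
  have h : Tendsto (fun n : ℕ => G (Set.Iic ((n : ℝ≥0) + 1)⁻¹)) atTop
      (𝓝 (G (⋂ n : ℕ, Set.Iic ((n : ℝ≥0) + 1)⁻¹))) := by
    refine tendsto_measure_iInter_atTop (fun n => measurableSet_Iic.nullMeasurableSet) ?_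
      ⟨0, measure_ne_top _ _⟩
    intro m n hmn
    refine Set.Iic_subset_Iic.2 ?_
    gcongr
  have h0 : (⋂ n : ℕ, Set.Iic ((n : ℝ≥0) + 1)⁻¹) = {0} := by
    ext x
    simp only [Set.mem_iInter, Set.mem_Iic, Set.mem_singleton_iff]
    refine ⟨fun hx => ?_, fun hx => by simp [hx]⟩
    simpa using ge_of_tendsto' tendsto_inv_natCast_add_one_nnreal hx
  rw [h0] at h
  obtain ⟨n, hn⟩ := (h.eventually_lt_const hc).exists
  exact ⟨_, by positivity, hn⟩

/-- Lower bound on the mass near zero, uniform over starting points in a compact range. -/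
theorem KernelDOA.eventually_forall_le_measure_Iic {K : Kernel ℝ≥0 ℝ≥0} [IsMarkovKernel K]
    {G : Measure ℝ≥0} [IsProbabilityMeasure G] (hK : KernelDOA K G) (n : ℕ) :
    ∀ᶠ t : ℝ≥0 in atTop, ∀ u : ℝ≥0, ((n : ℝ≥0) + 1)⁻¹ ≤ u → u ≤ n + 1 →
      G {0} - ((n : ℝ≥0∞) + 1)⁻¹ ≤ K (t * u) (Set.Iic (t * ((n : ℝ≥0) + 1)⁻¹)) := by
  rcases eq_or_ne (G {0}) 0 with h0 | h0
  · simp [h0]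
  have hn : (0 : ℝ≥0) < n + 1 := by positivity
  have hlt : G {0} - ((n : ℝ≥0∞) + 1)⁻¹ < G {0} :=
    ENNReal.sub_lt_self (measure_ne_top _ _) h0 (by simp)
  obtain ⟨T, hT⟩ := eventually_atTop.1 (hK.eventually_lt_measure_Iic
    (ε := ((n : ℝ≥0) + 1)⁻¹ * ((n : ℝ≥0) + 1)⁻¹) (by positivity) hlt)
  filter_upwards [eventually_ge_atTop (T * (n + 1))] with t ht u hu hu'
  have hTu : T ≤ t * u := calc
    T = T * (n + 1) * ((n : ℝ≥0) + 1)⁻¹ := by field_simp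
    _ ≤ t * u := by gcongr
  refine (hT _ hTu).le.trans (measure_mono (Set.Iic_subset_Iic.2 ?_))
  calc t * u * (((n : ℝ≥0) + 1)⁻¹ * ((n : ℝ≥0) + 1)⁻¹)
      ≤ t * (n + 1) * (((n : ℝ≥0) + 1)⁻¹ * ((n : ℝ≥0) + 1)⁻¹) := by gcongr
    _ = t * ((n : ℝ≥0) + 1)⁻¹ := by field_simp

/-- If `K ∈ D(G)`, then there exists a uniform extremal boundary: a function
`γ* : [0,∞) → [0,∞)` with `γ*(t) → 0` such that `K(t u_t, t[0,γ*(t)]) → G({0})` as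
`t → ∞` for every nonnegative function `u_t → u` with `u > 0`. -/
theorem exists_uniform_extremal_boundary (K : Kernel ℝ≥0 ℝ≥0) [IsMarkovKernel K]
    (G : Measure ℝ≥0) [IsProbabilityMeasure G] (hK : KernelDOA K G) :
    ∃ γ : ℝ≥0 → ℝ≥0, Tendsto γ atTop (𝓝 0) ∧
      ∀ (u : ℝ≥0) (ut : ℝ≥0 → ℝ≥0), 0 < u → Tendsto ut atTop (𝓝 u) →
        Tendsto (fun t : ℝ≥0 => (K (t * ut t)) (Set.Iic (t * γ t)))
          atTop (𝓝 (G {0})) := by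
  obtain ⟨N, hN, hP⟩ := exists_tendsto_atTop_eventually_diagonal _
    hK.eventually_forall_le_measure_Iic
  have hγ : Tendsto (fun t => ((N t : ℝ≥0) + 1)⁻¹) atTop (𝓝 0) :=
    tendsto_inv_natCast_add_one_nnreal.comp hN
  refine ⟨fun t => ((N t : ℝ≥0) + 1)⁻¹, hγ, fun u ut hu hut => ?_⟩
  refine tendsto_order.2 ⟨fun c hc => ?_, fun c hc => ?_⟩
  · have hsub : Tendsto (fun t => G {0} - ((N t : ℝ≥0∞) + 1)⁻¹) atTop (𝓝 (G {0})) := by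
      have h := ENNReal.Tendsto.sub (tendsto_const_nhds (x := G {0}))
        (ENNReal.tendsto_coe.2 hγ) (Or.inl (measure_ne_top _ _))
      simpa [ENNReal.coe_inv] using h
    filter_upwards [hP, hsub.eventually_const_lt hc, hγ.eventually_lt hut hu,
      hut.eventually_lt_const (lt_add_one u),
      (tendsto_natCast_atTop_atTop (R := ℝ≥0).comp hN).eventually_ge_atTop (u + 1)]
      with t h1 h2 h3 h4 h5
    exact h2.trans_le (h1 _ h3.le (h4.le.trans (h5.trans (by simp))))
  · obtain ⟨ε, hε, hlt⟩ := exists_pos_measure_Iic_lt hc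
    have hs : Tendsto (fun t => t * ut t) atTop atTop := by
      refine tendsto_atTop.2 fun b => ?_
      filter_upwards [hut.eventually_const_lt (NNReal.half_lt_self hu.ne'),
        eventually_ge_atTop (b / (u / 2))] with t h1 h2
      calc b = b / (u / 2) * (u / 2) := by field_simp
        _ ≤ t * ut t := by gcongr
    filter_upwards [hs.eventually (hK.eventually_measure_Iic_lt hlt),
      hγ.eventually_lt (hut.mul_const ε) (mul_pos hu hε)] with t h1 h2
    refine (measure_mono (Set.Iic_subset_Iic.2 ?_)).trans_lt h1
    rw [mul_assoc]
    gcongr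
end
end
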